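/- Let N ≥ 3, let 0 < q < 1 and p > 1/q (so that pq > 1 and p > 1), let a, b > −2, and assume the quadruple (p,q,a,b) is subcritical. Then the Hénon–Lane–Emden system (HLE) admits no positive solution that is stable outside a compact set. -/

import Mathlib

open MeasureTheory Metric Set

noncomputable section

/-- Euclidean space `ℝ^N`. -/
abbrev Euc (N : ℕ) := EuclideanSpace ℝ (Fin N)

/-- The Laplacian of a function `f : ℝ^N → ℝ`, as the sum of the pure second
partial derivatives. -/
def lap {N : ℕ} (f : Euc N → ℝ) (x : Euc N) : ℝ :=
  ∑ i : Fin N, iteratedFDeriv ℝ 2 f x ![EuclideanSpace.single i 1, EuclideanSpace.single i 1]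

/-- `(u, v)` is a solution of the Hénon–Lane–Emden system
`-Δu = |x|^a |v|^{p-1} v`, `-Δv = |x|^b |u|^{q-1} u` on `ℝ^N \ {0}`:
`u, v` are `C²` on `ℝ^N \ {0}`, continuous on `ℝ^N`, and satisfy the equations pointwise. -/
def IsHLESol {N : ℕ} (p q a b : ℝ) (u v : Euc N → ℝ) : Prop :=
  ContDiffOn ℝ 2 u {x : Euc N | x ≠ 0} ∧ ContDiffOn ℝ 2 v {x : Euc N | x ≠ 0} ∧
  Continuous u ∧ Continuous v ∧
  (∀ x : Euc N, x ≠ 0 → -lap u x = ‖x‖ ^ a * (|v x| ^ (p - 1) * v x)) ∧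
  (∀ x : Euc N, x ≠ 0 → -lap v x = ‖x‖ ^ b * (|u x| ^ (q - 1) * u x))

/-- Stability of a (positive) solution of the Hénon–Lane–Emden system on an open set `Ω`:
there exist positive `C²` functions `ξ, ζ` on `Ω` with
`-Δξ ≥ p |x|^a v^{p-1} ζ` and `-Δζ ≥ q |x|^b u^{q-1} ξ` on `Ω`. -/
def HLEStableOn {N : ℕ} (p q a b : ℝ) (u v : Euc N → ℝ) (Ω : Set (Euc N)) : Prop :=
  ∃ ξ ζ : Euc N → ℝ, ContDiffOn ℝ 2 ξ Ω ∧ ContDiffOn ℝ 2 ζ Ω ∧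
    (∀ x ∈ Ω, 0 < ξ x) ∧ (∀ x ∈ Ω, 0 < ζ x) ∧
    (∀ x ∈ Ω, p * ‖x‖ ^ a * v x ^ (p - 1) * ζ x ≤ -lap ξ x) ∧
    (∀ x ∈ Ω, q * ‖x‖ ^ b * u x ^ (q - 1) * ξ x ≤ -lap ζ x)

/-- Stability outside a compact set `K`: stability on every open set whose closure is
compact and contained in `ℝ^N \ K`. -/
def HLEStableOutside {N : ℕ} (p q a b : ℝ) (u v : Euc N → ℝ) (K : Set (Euc N)) : Prop :=
  IsCompact K ∧
    ∀ Ω : Set (Euc N), IsOpen Ω → IsCompact (closure Ω) → closure Ω ⊆ Kᶜ →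
      HLEStableOn p q a b u v Ω

/-- `(u, v)` solves the Lane–Emden system `-Δu = |v|^{p-1} v`, `-Δv = |u|^{q-1} u` on `ℝ^N`. -/
def IsLESol {N : ℕ} (p q : ℝ) (u v : Euc N → ℝ) : Prop :=
  (∀ x : Euc N, -lap u x = |v x| ^ (p - 1) * v x) ∧
  (∀ x : Euc N, -lap v x = |u x| ^ (q - 1) * u x)

/-- Stability of a (positive) solution of the Lane–Emden system on an open set `Ω`. -/
def LEStableOn {N : ℕ} (p q : ℝ) (u v : Euc N → ℝ) (Ω : Set (Euc N)) : Prop :=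
  ∃ ξ ζ : Euc N → ℝ, ContDiffOn ℝ 2 ξ Ω ∧ ContDiffOn ℝ 2 ζ Ω ∧
    (∀ x ∈ Ω, 0 < ξ x) ∧ (∀ x ∈ Ω, 0 < ζ x) ∧
    (∀ x ∈ Ω, p * v x ^ (p - 1) * ζ x ≤ -lap ξ x) ∧
    (∀ x ∈ Ω, q * u x ^ (q - 1) * ξ x ≤ -lap ζ x)

/-- A function on `ℝ^N` is polynomially bounded. -/
def PolyBounded {N : ℕ} (w : Euc N → ℝ) : Prop :=
  ∃ K L R : ℝ, 0 < K ∧ 0 < L ∧ ∀ x : Euc N, R ≤ ‖x‖ → |w x| ≤ K * ‖x‖ ^ L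

/-- The polynomial `G` from Theorem 1.4 (iii). -/
def Gpoly (p q x : ℝ) : ℝ :=
  x ^ 4 - (4 * p * q * (q + 1) / (p + 1)) * x ^ 2 +
    (2 * p * q * (q + 1) * (p + q + 2) / (p + 1) ^ 2) * x -
    p * q * (q + 1) ^ 2 / (p + 1) ^ 2

namespace HLE

variable {N : ℕ}

/-- The `i`-th partial derivative. -/
def pd (i : Fin N) (f : Euc N → ℝ) (x : Euc N) : ℝ := fderiv ℝ f x (EuclideanSpace.single i 1)

/-- The pointwise inner product of the gradients of `f` and `g`. -/
def gdot (f g : Euc N → ℝ) (x : Euc N) : ℝ := ∑ i, pd i f x * pd i g x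

lemma gdot_comm (f g : Euc N → ℝ) (x : Euc N) : gdot f g x = gdot g f x := by
  simp only [gdot, mul_comm]

lemma gdot_self_nonneg (f : Euc N → ℝ) (x : Euc N) : 0 ≤ gdot f f x :=
  Finset.sum_nonneg fun _ _ => mul_self_nonneg _

lemma gdot_sq_le (f g : Euc N → ℝ) (x : Euc N) : gdot f g x ^ 2 ≤ gdot f f x * gdot g g x := by
  have h := Finset.sum_mul_sq_le_sq_mul_sq Finset.univ (fun i => pd i f x) (fun i => pd i g x)
  simpa only [gdot, sq] using h

lemma eventually_contDiffAt {f : Euc N → ℝ} {x : Euc N} (hf : ContDiffAt ℝ 2 f x) :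
    ∀ᶠ y in nhds x, DifferentiableAt ℝ f y :=
  (hf.eventually (by simp)).mono fun _ h => h.differentiableAt (by simp)

lemma contDiffAt_pd {f : Euc N → ℝ} {x : Euc N} (hf : ContDiffAt ℝ 2 f x) (i : Fin N) :
    ContDiffAt ℝ 1 (pd i f) x :=
  (hf.fderiv_right (m := 1) (by norm_num)).clm_apply contDiffAt_const

lemma differentiableAt_pd {f : Euc N → ℝ} {x : Euc N} (hf : ContDiffAt ℝ 2 f x) (i : Fin N) :
    DifferentiableAt ℝ (pd i f) x :=
  (contDiffAt_pd hf i).differentiableAt (by simp)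

lemma pd_congr {f g : Euc N → ℝ} {x : Euc N} (h : f =ᶠ[nhds x] g) (i : Fin N) :
    pd i f x = pd i g x := by
  simp only [pd, h.fderiv_eq]

lemma pd_const (c : ℝ) (i : Fin N) (x : Euc N) : pd i (fun _ => c) x = 0 := by
  simp [pd]

lemma pd_add {f g : Euc N → ℝ} {x : Euc N} (hf : DifferentiableAt ℝ f x)
    (hg : DifferentiableAt ℝ g x) (i : Fin N) :
    pd i (fun y => f y + g y) x = pd i f x + pd i g x := by
  simp [pd, fderiv_fun_add hf hg]

lemma pd_sub {f g : Euc N → ℝ} {x : Euc N} (hf : DifferentiableAt ℝ f x)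
    (hg : DifferentiableAt ℝ g x) (i : Fin N) :
    pd i (fun y => f y - g y) x = pd i f x - pd i g x := by
  simp [pd, fderiv_fun_sub hf hg]

lemma pd_mul {f g : Euc N → ℝ} {x : Euc N} (hf : DifferentiableAt ℝ f x)
    (hg : DifferentiableAt ℝ g x) (i : Fin N) :
    pd i (fun y => f y * g y) x = f x * pd i g x + g x * pd i f x := by
  simp [pd, fderiv_fun_mul hf hg]

lemma pd_const_mul {f : Euc N → ℝ} {x : Euc N} (hf : DifferentiableAt ℝ f x) (c : ℝ)
    (i : Fin N) : pd i (fun y => c * f y) x = c * pd i f x := by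
  simp [pd, fderiv_const_mul hf]

lemma pd_sum {ι : Type*} (s : Finset ι) {f : ι → Euc N → ℝ} {x : Euc N}
    (hf : ∀ j ∈ s, DifferentiableAt ℝ (f j) x) (i : Fin N) :
    pd i (fun y => ∑ j ∈ s, f j y) x = ∑ j ∈ s, pd i (f j) x := by
  simp [pd, fderiv_fun_sum hf]

lemma pd_comp {f : Euc N → ℝ} {h : ℝ → ℝ} {h' : ℝ} {x : Euc N} (hh : HasDerivAt h h' (f x))
    (hf : DifferentiableAt ℝ f x) (i : Fin N) :
    pd i (fun y => h (f y)) x = h' * pd i f x := by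
  have := hh.comp_hasFDerivAt x hf.hasFDerivAt
  simp only [pd]
  rw [show (fun y => h (f y)) = h ∘ f from rfl, this.fderiv]
  simp

lemma pd_pd {f : Euc N → ℝ} {x : Euc N} (hd : DifferentiableAt ℝ (fderiv ℝ f) x) (i j : Fin N) :
    pd i (pd j f) x =
      fderiv ℝ (fderiv ℝ f) x (EuclideanSpace.single i 1) (EuclideanSpace.single j 1) := by
  change fderiv ℝ (fun y => fderiv ℝ f y (EuclideanSpace.single j 1)) x
    (EuclideanSpace.single i 1) = _
  rw [fderiv_clm_apply hd (differentiableAt_const _)]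
  simp

lemma lap_eq {f : Euc N → ℝ} {x : Euc N} (hf : ContDiffAt ℝ 2 f x) :
    lap f x = ∑ i, pd i (pd i f) x := by
  have hd : DifferentiableAt ℝ (fderiv ℝ f) x :=
    (hf.fderiv_right (m := 1) (by norm_num)).differentiableAt (by simp)
  refine Finset.sum_congr rfl fun i _ => ?_
  rw [iteratedFDeriv_two_apply, pd_pd hd]
  simp

lemma pd_comm {f : Euc N → ℝ} {x : Euc N} (hf : ContDiffAt ℝ 2 f x) (i j : Fin N) :
    pd i (pd j f) x = pd j (pd i f) x := by
  have hd : DifferentiableAt ℝ (fderiv ℝ f) x :=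
    (hf.fderiv_right (m := 1) (by norm_num)).differentiableAt (by simp)
  have key : ∀ k l : Fin N, pd k (pd l f) x =
      fderiv ℝ (fderiv ℝ f) x (EuclideanSpace.single k 1) (EuclideanSpace.single l 1) :=
    fun k l => pd_pd hd k l
  rw [key, key]
  exact hf.isSymmSndFDerivAt (by simp) _ _

lemma lap_mul {f g : Euc N → ℝ} {x : Euc N} (hf : ContDiffAt ℝ 2 f x) (hg : ContDiffAt ℝ 2 g x) :
    lap (fun y => f y * g y) x = f x * lap g x + 2 * gdot f g x + g x * lap f x := by
  rw [lap_eq (hf.mul hg), lap_eq hf, lap_eq hg, gdot, Finset.mul_sum, Finset.mul_sum,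
    Finset.mul_sum, ← Finset.sum_add_distrib, ← Finset.sum_add_distrib]
  refine Finset.sum_congr rfl fun i _ => ?_
  have hf1 := hf.differentiableAt (by simp)
  have hg1 := hg.differentiableAt (by simp)
  have h : pd i (fun y => f y * g y) =ᶠ[nhds x] fun y => f y * pd i g y + g y * pd i f y := by
    filter_upwards [eventually_contDiffAt hf, eventually_contDiffAt hg] with y h1 h2
    exact pd_mul h1 h2 i
  rw [pd_congr h, pd_add (hf1.fun_mul (differentiableAt_pd hg i))
      (hg1.fun_mul (differentiableAt_pd hf i)),
    pd_mul hf1 (differentiableAt_pd hg i), pd_mul hg1 (differentiableAt_pd hf i)]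
  ring

lemma lap_sub {f g : Euc N → ℝ} {x : Euc N} (hf : ContDiffAt ℝ 2 f x) (hg : ContDiffAt ℝ 2 g x) :
    lap (fun y => f y - g y) x = lap f x - lap g x := by
  rw [lap_eq (hf.sub hg), lap_eq hf, lap_eq hg, ← Finset.sum_sub_distrib]
  refine Finset.sum_congr rfl fun i _ => ?_
  have h : pd i (fun y => f y - g y) =ᶠ[nhds x] fun y => pd i f y - pd i g y := by
    filter_upwards [eventually_contDiffAt hf, eventually_contDiffAt hg] with y h1 h2
    exact pd_sub h1 h2 i
  rw [pd_congr h, pd_sub (differentiableAt_pd hf i) (differentiableAt_pd hg i)]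

lemma lap_comp {f : Euc N → ℝ} {h h' : ℝ → ℝ} {h'' : ℝ} {x : Euc N}
    (hh : ∀ᶠ t in nhds (f x), HasDerivAt h (h' t) t) (hh' : HasDerivAt h' h'' (f x))
    (hf : ContDiffAt ℝ 2 f x) (hhf : ContDiffAt ℝ 2 (fun y => h (f y)) x) :
    lap (fun y => h (f y)) x = h' (f x) * lap f x + h'' * gdot f f x := by
  rw [lap_eq hhf, lap_eq hf, gdot, Finset.mul_sum, Finset.mul_sum, ← Finset.sum_add_distrib]
  refine Finset.sum_congr rfl fun i _ => ?_
  have hf1 := hf.differentiableAt (by simp)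
  have e : pd i (fun y => h (f y)) =ᶠ[nhds x] fun y => h' (f y) * pd i f y := by
    filter_upwards [eventually_contDiffAt hf, hf.continuousAt.eventually hh] with y h1 h2
    exact pd_comp h2 h1 i
  have hd : DifferentiableAt ℝ (fun y => h' (f y)) x :=
    (hh'.comp_hasFDerivAt x hf1.hasFDerivAt).differentiableAt
  rw [pd_congr e, pd_mul hd (differentiableAt_pd hf i), pd_comp hh' hf1]
  ring

lemma pd_rpow {f : Euc N → ℝ} {x : Euc N} (hf : DifferentiableAt ℝ f x) (h0 : 0 < f x) (s : ℝ)
    (i : Fin N) : pd i (fun y => f y ^ s) x = s * f x ^ (s - 1) * pd i f x :=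
  pd_comp (Real.hasDerivAt_rpow_const (Or.inl h0.ne')) hf i

lemma lap_rpow {f : Euc N → ℝ} {x : Euc N} (hf : ContDiffAt ℝ 2 f x) (h0 : 0 < f x) (s : ℝ) :
    lap (fun y => f y ^ s) x =
      s * f x ^ (s - 1) * lap f x + s * (s - 1) * f x ^ (s - 2) * gdot f f x := by
  rw [lap_comp (h := fun t => t ^ s) (h' := fun t => s * t ^ (s - 1)) (h'' := s * ((s - 1) * f x ^ (s - 1 - 1))) ?_ ?_ hf
    (hf.rpow_const_of_ne h0.ne')]
  · rw [show s - 1 - 1 = s - 2 by ring]; ring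
  · filter_upwards [lt_mem_nhds h0] with t ht
    exact Real.hasDerivAt_rpow_const (Or.inl ht.ne')
  · exact (Real.hasDerivAt_rpow_const (Or.inl h0.ne')).const_mul s

lemma pd_pow {f : Euc N → ℝ} {x : Euc N} (hf : DifferentiableAt ℝ f x) (n : ℕ)
    (i : Fin N) : pd i (fun y => f y ^ n) x = n * f x ^ (n - 1) * pd i f x :=
  pd_comp (h := fun t => t ^ n) (by simpa using hasDerivAt_pow n (f x)) hf i

lemma lap_pow {f : Euc N → ℝ} {x : Euc N} (hf : ContDiffAt ℝ 2 f x) (n : ℕ) :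
    lap (fun y => f y ^ (n + 2)) x =
      (n + 2) * f x ^ (n + 1) * lap f x + (n + 2) * (n + 1) * f x ^ n * gdot f f x := by
  rw [lap_comp (h := fun t => t ^ (n + 2)) (h' := fun t => (n + 2) * t ^ (n + 1))
    (h'' := (n + 2) * ((n + 1) * f x ^ n)) ?_ ?_ hf (hf.pow _)]
  · ring
  · refine Filter.Eventually.of_forall fun t => ?_
    simpa using hasDerivAt_pow (n + 2) t
  · simpa using (hasDerivAt_pow (n + 1) (f x)).const_mul ((n : ℝ) + 2)

lemma gdot_mul_left {f g h : Euc N → ℝ} {x : Euc N} (hf : DifferentiableAt ℝ f x)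
    (hg : DifferentiableAt ℝ g x) :
    gdot (fun y => f y * g y) h x = f x * gdot g h x + g x * gdot f h x := by
  simp only [gdot, Finset.mul_sum, ← Finset.sum_add_distrib]
  refine Finset.sum_congr rfl fun i _ => ?_
  rw [pd_mul hf hg]; ring

lemma gdot_rpow_left {f h : Euc N → ℝ} {x : Euc N} (hf : DifferentiableAt ℝ f x) (h0 : 0 < f x)
    (s : ℝ) : gdot (fun y => f y ^ s) h x = s * f x ^ (s - 1) * gdot f h x := by
  simp only [gdot, Finset.mul_sum]
  refine Finset.sum_congr rfl fun i _ => ?_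
  rw [pd_rpow hf h0]; ring

lemma gdot_pow_self {f : Euc N → ℝ} {x : Euc N} (hf : DifferentiableAt ℝ f x) (n : ℕ) :
    gdot (fun y => f y ^ n) (fun y => f y ^ n) x = (n * f x ^ (n - 1)) ^ 2 * gdot f f x := by
  simp only [gdot, Finset.mul_sum]
  refine Finset.sum_congr rfl fun i _ => ?_
  rw [pd_pow hf]; ring

lemma gdot_sub_self_le {f g : Euc N → ℝ} {x : Euc N} (hf : DifferentiableAt ℝ f x)
    (hg : DifferentiableAt ℝ g x) :
    gdot (fun y => f y - g y) (fun y => f y - g y) x ≤ 2 * gdot f f x + 2 * gdot g g x := by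
  simp only [gdot, Finset.mul_sum, ← Finset.sum_add_distrib]
  refine Finset.sum_le_sum fun i _ => ?_
  rw [pd_sub hf hg]
  nlinarith [sq_nonneg (pd i f x + pd i g x)]

/-! ### Continuity and integration by parts -/

lemma continuousOn_pd {f : Euc N → ℝ} {U : Set (Euc N)} (hU : IsOpen U) (hf : ContDiffOn ℝ 2 f U)
    (i : Fin N) : ContinuousOn (pd i f) U := fun _ hx =>
  (contDiffAt_pd (hf.contDiffAt (hU.mem_nhds hx)) i).continuousAt.continuousWithinAt

lemma continuousOn_gdot {f g : Euc N → ℝ} {U : Set (Euc N)} (hU : IsOpen U)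
    (hf : ContDiffOn ℝ 2 f U) (hg : ContDiffOn ℝ 2 g U) : ContinuousOn (gdot f g) U :=
  continuousOn_finsetSum _ fun i _ => (continuousOn_pd hU hf i).mul (continuousOn_pd hU hg i)

lemma continuousOn_lap {f : Euc N → ℝ} {U : Set (Euc N)} (hU : IsOpen U)
    (hf : ContDiffOn ℝ 2 f U) : ContinuousOn (lap f) U := by
  refine continuousOn_finsetSum _ fun i _ => ?_
  have h1 : ContDiffOn ℝ 1 (fderiv ℝ f) U := hf.fderiv_of_isOpen hU (by norm_num)
  have h2 : ContinuousOn (fderiv ℝ (fderiv ℝ f)) U :=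
    (h1.fderiv_of_isOpen (m := 0) hU (by norm_num)).continuousOn
  simp only [iteratedFDeriv_two_apply]
  exact (h2.clm_apply continuousOn_const).clm_apply continuousOn_const

lemma eventuallyEq_zero {f : Euc N → ℝ} {S : Set (Euc N)} (hS : IsCompact S)
    (h0 : ∀ x ∉ S, f x = 0) {x : Euc N} (hx : x ∉ S) : f =ᶠ[nhds x] fun _ => 0 := by
  filter_upwards [hS.isClosed.isOpen_compl.mem_nhds hx] with y hy using h0 y hy

lemma pd_eq_zero {f : Euc N → ℝ} {S : Set (Euc N)} (hS : IsCompact S)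
    (h0 : ∀ x ∉ S, f x = 0) (i : Fin N) {x : Euc N} (hx : x ∉ S) : pd i f x = 0 := by
  rw [pd_congr (eventuallyEq_zero hS h0 hx), pd_const]

lemma gdot_eq_zero {f : Euc N → ℝ} (g : Euc N → ℝ) {S : Set (Euc N)} (hS : IsCompact S)
    (h0 : ∀ x ∉ S, f x = 0) {x : Euc N} (hx : x ∉ S) : gdot f g x = 0 := by
  simp [gdot, pd_eq_zero hS h0 _ hx]

lemma lap_eq_zero {f : Euc N → ℝ} {S : Set (Euc N)} (hS : IsCompact S)
    (h0 : ∀ x ∉ S, f x = 0) {x : Euc N} (hx : x ∉ S) : lap f x = 0 := by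
  have h := eventuallyEq_zero hS h0 hx
  rw [lap_eq (contDiffAt_const.congr_of_eventuallyEq h)]
  exact Finset.sum_eq_zero fun i _ => pd_eq_zero hS (fun y hy => pd_eq_zero hS h0 i hy) i hx

lemma integrable_of_continuousOn {f : Euc N → ℝ} {S : Set (Euc N)} (hS : IsCompact S)
    (hf : ContinuousOn f S) (h0 : ∀ x ∉ S, f x = 0) : Integrable f := by
  rw [← integrableOn_iff_integrable_of_support_subset (s := S)]
  · exact hf.integrableOn_compact hS
  · intro x hx
    by_contra h
    exact hx (h0 x h)

lemma contDiff_of_contDiffOn {n : WithTop ℕ∞} {f : Euc N → ℝ} {U S : Set (Euc N)} (hU : IsOpen U)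
    (hS : IsCompact S) (hSU : S ⊆ U) (hf : ContDiffOn ℝ n f U) (h0 : ∀ x ∉ S, f x = 0) :
    ContDiff ℝ n f := by
  rw [contDiff_iff_contDiffAt]
  intro x
  by_cases hx : x ∈ S
  · exact hf.contDiffAt (hU.mem_nhds (hSU hx))
  · exact contDiffAt_const.congr_of_eventuallyEq (eventuallyEq_zero hS h0 hx)

lemma integral_pd_eq_zero {f : Euc N → ℝ} {U S : Set (Euc N)} (hU : IsOpen U)
    (hS : IsCompact S) (hSU : S ⊆ U) (hf : ContDiffOn ℝ 1 f U) (h0 : ∀ x ∉ S, f x = 0)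
    (i : Fin N) : Integrable (pd i f) ∧ ∫ x, pd i f x = 0 := by
  have hc := contDiff_of_contDiffOn hU hS hSU hf h0
  have hcont : Continuous (pd i f) := (hc.continuous_fderiv (by simp)).clm_apply continuous_const
  have hi : Integrable fun x => pd i f x :=
    integrable_of_continuousOn hS hcont.continuousOn fun x hx => pd_eq_zero hS h0 i hx
  refine ⟨hi, ?_⟩
  have h := integral_mul_fderiv_eq_neg_fderiv_mul_of_integrable (μ := volume)
    (f := fun _ : Euc N => (1 : ℝ)) (g := f) (v := EuclideanSpace.single i 1)
    (by simp) (by simpa only [one_mul, pd] using hi)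
    (by simpa using integrable_of_continuousOn hS hc.continuous.continuousOn h0)
    (fun x _ => differentiableAt_const _) (fun x _ => hc.differentiable (by simp) x)
  simpa [pd] using h

lemma integral_div_eq_zero {F : Fin N → Euc N → ℝ} {U S : Set (Euc N)} (hU : IsOpen U)
    (hS : IsCompact S) (hSU : S ⊆ U) (hf : ∀ i, ContDiffOn ℝ 1 (F i) U)
    (h0 : ∀ i, ∀ x ∉ S, F i x = 0) : ∫ x, ∑ i, pd i (F i) x = 0 := by
  rw [integral_finsetSum _ fun i _ => (integral_pd_eq_zero hU hS hSU (hf i) (h0 i) i).1]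
  exact Finset.sum_eq_zero fun i _ => (integral_pd_eq_zero hU hS hSU (hf i) (h0 i) i).2

lemma contDiffOn_pd {f : Euc N → ℝ} {U : Set (Euc N)} (hU : IsOpen U) (hf : ContDiffOn ℝ 2 f U)
    (i : Fin N) : ContDiffOn ℝ 1 (pd i f) U := fun _ hx =>
  (contDiffAt_pd (hf.contDiffAt (hU.mem_nhds hx)) i).contDiffWithinAt

/-- Green's second identity for a compactly supported function. -/
lemma integral_mul_lap_comm {f g : Euc N → ℝ} {U S : Set (Euc N)} (hU : IsOpen U)
    (hS : IsCompact S) (hSU : S ⊆ U) (hf : ContDiffOn ℝ 2 f U) (hg : ContDiffOn ℝ 2 g U)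
    (h0 : ∀ x ∉ S, g x = 0) : ∫ x, f x * lap g x = ∫ x, lap f x * g x := by
  have hfl := continuousOn_lap hU hf
  have hgl := continuousOn_lap hU hg
  have h1 : Integrable fun x => f x * lap g x :=
    integrable_of_continuousOn hS ((hf.continuousOn.mul hgl).mono hSU)
      fun x hx => by rw [lap_eq_zero hS h0 hx, mul_zero]
  have h2 : Integrable fun x => lap f x * g x :=
    integrable_of_continuousOn hS ((hfl.mul hg.continuousOn).mono hSU)
      fun x hx => by rw [h0 x hx, mul_zero]
  rw [← sub_eq_zero, ← integral_sub h1 h2]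
  have h3 := integral_div_eq_zero (F := fun i y => f y * pd i g y - g y * pd i f y) hU hS hSU
    (fun i => ((hf.of_le (by norm_num)).mul (contDiffOn_pd hU hg i)).sub
      ((hg.of_le (by norm_num)).mul (contDiffOn_pd hU hf i)))
    (fun i x hx => by simp [h0 x hx, pd_eq_zero hS h0 i hx])
  rw [← h3]
  refine integral_congr_ae (Filter.Eventually.of_forall fun x => ?_)
  by_cases hx : x ∈ S
  · have hfx := hf.contDiffAt (hU.mem_nhds (hSU hx))
    have hgx := hg.contDiffAt (hU.mem_nhds (hSU hx))
    have hf1 := hfx.differentiableAt (by simp)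
    have hg1 := hgx.differentiableAt (by simp)
    simp only
    rw [lap_eq hfx, lap_eq hgx, Finset.mul_sum, Finset.sum_mul, ← Finset.sum_sub_distrib]
    refine Finset.sum_congr rfl fun i _ => ?_
    rw [pd_sub (hf1.fun_mul (differentiableAt_pd hgx i)) (hg1.fun_mul (differentiableAt_pd hfx i)),
      pd_mul hf1 (differentiableAt_pd hgx i), pd_mul hg1 (differentiableAt_pd hfx i)]
    ring
  · have : ∀ i : Fin N, pd i (fun y => f y * pd i g y - g y * pd i f y) x = 0 := fun i =>
      pd_eq_zero hS (fun y hy => by simp [h0 y hy, pd_eq_zero hS h0 i hy]) i hx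
    simp [this, h0 x hx, lap_eq_zero hS h0 hx]

lemma lap_congr {f g : Euc N → ℝ} {x : Euc N} (hf : ContDiffAt ℝ 2 f x) (h : f =ᶠ[nhds x] g) :
    lap f x = lap g x := by
  rw [lap_eq hf, lap_eq (hf.congr_of_eventuallyEq h.symm)]
  refine Finset.sum_congr rfl fun i _ => pd_congr ?_ i
  filter_upwards [h.eventuallyEq_nhds] with y hy using pd_congr hy i

/-- The integral form of stability. -/
lemma integral_stability {ξ ζ φ P Q : Euc N → ℝ} {Ω S : Set (Euc N)} (hΩ : IsOpen Ω)
    (hS : IsCompact S) (hSΩ : S ⊆ Ω) (hξ : ContDiffOn ℝ 2 ξ Ω) (hζ : ContDiffOn ℝ 2 ζ Ω)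
    (hξ0 : ∀ x ∈ Ω, 0 < ξ x) (hζ0 : ∀ x ∈ Ω, 0 < ζ x) (hP : ContinuousOn P Ω)
    (hQ : ContinuousOn Q Ω) (hQ0 : ∀ x ∈ Ω, 0 < Q x) (h1 : ∀ x ∈ Ω, P x * ζ x ≤ -lap ξ x)
    (h2 : ∀ x ∈ Ω, Q x * ξ x ≤ -lap ζ x) (hφ : ContDiffOn ℝ 2 φ Ω) (h0 : ∀ x ∉ S, φ x = 0) :
    ∫ x, P x * φ x ^ 2 ≤ ∫ x, lap φ x ^ 2 / Q x := by
  set w : Euc N → ℝ := fun y => φ y / ζ y with hw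
  set g : Euc N → ℝ := fun y => φ y * w y with hg
  have hwC : ContDiffOn ℝ 2 w Ω := hφ.div hζ fun x hx => (hζ0 x hx).ne'
  have hgC : ContDiffOn ℝ 2 g Ω := hφ.mul hwC
  have hg0 : ∀ x ∉ S, g x = 0 := fun x hx => by simp [hg, h0 x hx]
  have green := integral_mul_lap_comm hΩ hS hSΩ hξ hgC hg0
  have hlξ := continuousOn_lap hΩ hξ
  have hlg := continuousOn_lap hΩ hgC
  have hlφ := continuousOn_lap hΩ hφ
  have i1 : Integrable fun x => P x * φ x ^ 2 :=
    integrable_of_continuousOn hS ((hP.mul (hφ.continuousOn.pow 2)).mono hSΩ)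
      fun x hx => by simp [h0 x hx]
  have i2 : Integrable fun x => -(lap ξ x * g x) :=
    integrable_of_continuousOn hS ((hlξ.mul hgC.continuousOn).neg.mono hSΩ)
      fun x hx => by simp [hg0 x hx]
  have i3 : Integrable fun x => -(ξ x * lap g x) :=
    integrable_of_continuousOn hS ((hξ.continuousOn.mul hlg).neg.mono hSΩ)
      fun x hx => by simp [lap_eq_zero hS hg0 hx]
  have i4 : Integrable fun x => lap φ x ^ 2 / Q x :=
    integrable_of_continuousOn hS (((hlφ.pow 2).div hQ fun x hx => (hQ0 x hx).ne').mono hSΩ)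
      fun x hx => by simp [lap_eq_zero hS h0 hx]
  calc ∫ x, P x * φ x ^ 2 ≤ ∫ x, -(lap ξ x * g x) := by
        refine integral_mono i1 i2 fun x => ?_
        by_cases hx : x ∈ S
        · have hz := hζ0 x (hSΩ hx)
          have e : P x * φ x ^ 2 = P x * ζ x * (φ x ^ 2 / ζ x) := by field_simp
          simp only
          rw [e, ← neg_mul]
          have e' : g x = φ x ^ 2 / ζ x := by simp only [hg, hw]; ring
          rw [e']
          exact mul_le_mul_of_nonneg_right (h1 x (hSΩ hx)) (by positivity)
        · simp [h0 x hx, hg0 x hx]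
    _ = ∫ x, -(ξ x * lap g x) := by rw [integral_neg, integral_neg, green]
    _ ≤ ∫ x, lap φ x ^ 2 / Q x := by
        refine integral_mono i3 i4 fun x => ?_
        by_cases hx : x ∈ S
        · have hxΩ := hΩ.mem_nhds (hSΩ hx)
          have cφ := hφ.contDiffAt hxΩ
          have cw := hwC.contDiffAt hxΩ
          have cζ := hζ.contDiffAt hxΩ
          have eφ : φ =ᶠ[nhds x] fun y => ζ y * w y := by
            filter_upwards [hxΩ] with y hy
            have := hζ0 y hy
            simp only [hw]; field_simp
          have e1 : lap φ x = ζ x * lap w x + 2 * gdot ζ w x + w x * lap ζ x := by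
            rw [lap_congr cφ eφ, lap_mul cζ cw]
          have e2 : gdot φ w x = ζ x * gdot w w x + w x * gdot ζ w x := by
            rw [← gdot_mul_left (cζ.differentiableAt (by simp)) (cw.differentiableAt (by simp))]
            simp only [gdot]
            refine Finset.sum_congr rfl fun i _ => by rw [pd_congr eφ]
          have e3 : lap g x = φ x * lap w x + 2 * gdot φ w x + w x * lap φ x := lap_mul cφ cw
          have e4 : φ x = ζ x * w x := eφ.eq_of_nhds
          have hq := hQ0 x (hSΩ hx)
          have hx1 := hξ0 x (hSΩ hx)
          have hz := hζ0 x (hSΩ hx)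
          have hg2 := gdot_self_nonneg w x
          have e5 : -(ξ x * lap g x) = -2 * (ξ x * w x) * lap φ x + ξ x * w x ^ 2 * lap ζ x
              - 2 * ξ x * ζ x * gdot w w x := by
            rw [e3, e2, e4, e1]; ring
          simp only
          rw [le_div_iff₀ hq, e5]
          have a1 : ξ x * w x ^ 2 * (Q x * ξ x) ≤ ξ x * w x ^ 2 * (-lap ζ x) :=
            mul_le_mul_of_nonneg_left (h2 x (hSΩ hx)) (by positivity)
          have a2 : 0 ≤ 2 * ξ x * ζ x * gdot w w x := by positivity
          have a3 : -2 * (ξ x * w x) * lap φ x + ξ x * w x ^ 2 * lap ζ x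
              - 2 * ξ x * ζ x * gdot w w x ≤
              -2 * (ξ x * w x) * lap φ x - Q x * (ξ x * w x) ^ 2 := by nlinarith
          have a4 := mul_le_mul_of_nonneg_right a3 hq.le
          nlinarith [sq_nonneg (lap φ x + Q x * (ξ x * w x))]
        · simp [lap_eq_zero hS hg0 hx, lap_eq_zero hS h0 hx]

/-- The energy estimate for stable solutions of `-Δu = f`, `-Δv = g`, where `f` and `g` are the
nonlinearities with linearizations `p * f / v` and `q * g / u`. -/
lemma integral_energy_le {u v f g ξ ζ η : Euc N → ℝ} {p q : ℝ} {Ω S : Set (Euc N)}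
    (hq0 : 0 < q) (hpq : 1 < p * q) (hΩ : IsOpen Ω)
    (hS : IsCompact S) (hSΩ : S ⊆ Ω) (hξ : ContDiffOn ℝ 2 ξ Ω) (hζ : ContDiffOn ℝ 2 ζ Ω)
    (hξ0 : ∀ x ∈ Ω, 0 < ξ x) (hζ0 : ∀ x ∈ Ω, 0 < ζ x)
    (hu : ContDiffOn ℝ 2 u Ω) (hv : ContDiffOn ℝ 2 v Ω)
    (hu0 : ∀ x ∈ Ω, 0 < u x) (hv0 : ∀ x ∈ Ω, 0 < v x)
    (hf : ContinuousOn f Ω) (hg : ContinuousOn g Ω) (hg0 : ∀ x ∈ Ω, 0 < g x)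
    (hfu : ∀ x ∈ Ω, -lap u x = f x) (hgv : ∀ x ∈ Ω, -lap v x = g x)
    (h1 : ∀ x ∈ Ω, p * (f x / v x) * ζ x ≤ -lap ξ x)
    (h2 : ∀ x ∈ Ω, q * (g x / u x) * ξ x ≤ -lap ζ x)
    (hη : ContDiffOn ℝ 2 η Ω) (h0 : ∀ x ∉ S, η x = 0) :
    ∫ x, (f x * v x + g x * u x) * η x ^ 2 ≤ (6 / (p * q - 1) + 4) *
      ∫ x, (u x * v x * gdot η η x +
        u x / g x * (8 * gdot v v x * gdot η η x + 2 * v x ^ 2 * lap η x ^ 2)) := by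
  have hlη := continuousOn_lap hΩ hη
  have hgη := continuousOn_gdot hΩ hη hη
  have hgv' := continuousOn_gdot hΩ hv hη
  have hgvv := continuousOn_gdot hΩ hv hv
  have cu := hu.continuousOn
  have cv := hv.continuousOn
  have cη := hη.continuousOn
  have cug : ContinuousOn (fun x => u x / g x) Ω := cu.div hg fun x hx => (hg0 x hx).ne'
  set h : Euc N → ℝ := fun x => 2 * gdot v η x + v x * lap η x with hh
  have ch : ContinuousOn h Ω := (continuousOn_const.mul hgv').add (cv.mul hlη)
  have hh0 : ∀ x ∉ S, h x = 0 := fun x hx => by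
    simp [hh, lap_eq_zero hS h0 hx, gdot_comm v, gdot_eq_zero v hS h0 hx]
  have iX : Integrable fun x => f x * v x * η x ^ 2 :=
    integrable_of_continuousOn hS (((hf.mul cv).mul (cη.pow 2)).mono hSΩ)
      fun x hx => by simp [h0 x hx]
  have iY : Integrable fun x => g x * u x * η x ^ 2 :=
    integrable_of_continuousOn hS (((hg.mul cu).mul (cη.pow 2)).mono hSΩ)
      fun x hx => by simp [h0 x hx]
  have iM : Integrable fun x => u x * η x * h x :=
    integrable_of_continuousOn hS (((cu.mul cη).mul ch).mono hSΩ)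
      fun x hx => by simp [h0 x hx]
  have iT : Integrable fun x => u x * v x * gdot η η x :=
    integrable_of_continuousOn hS (((cu.mul cv).mul hgη).mono hSΩ)
      fun x hx => by simp [gdot_eq_zero η hS h0 hx]
  have iH : Integrable fun x => u x / g x * h x ^ 2 :=
    integrable_of_continuousOn hS ((cug.mul (ch.pow 2)).mono hSΩ)
      fun x hx => by simp [hh0 x hx]
  have iH' : Integrable fun x =>
      u x / g x * (8 * gdot v v x * gdot η η x + 2 * v x ^ 2 * lap η x ^ 2) :=
    integrable_of_continuousOn hS ((cug.mul (((continuousOn_const.mul hgvv).mul hgη).add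
      ((continuousOn_const.mul (cv.pow 2)).mul (hlη.pow 2)))).mono hSΩ)
      fun x hx => by simp [gdot_eq_zero η hS h0 hx, lap_eq_zero hS h0 hx]
  have iYM : Integrable fun x => g x * u x * η x ^ 2 - 2 * (u x * η x * h x) :=
    iY.sub (iM.const_mul 2)
  have stab : p * ∫ x, f x * v x * η x ^ 2 ≤
      (1 / q) * ((∫ x, g x * u x * η x ^ 2) - 2 * (∫ x, u x * η x * h x)
        + ∫ x, u x / g x * h x ^ 2) := by
    have hst := integral_stability hΩ hS hSΩ hξ hζ hξ0 hζ0
      (P := fun x => p * (f x / v x)) (Q := fun x => q * (g x / u x))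
      (φ := fun x => v x * η x)
      (continuousOn_const.mul (hf.div cv fun x hx => (hv0 x hx).ne'))
      (continuousOn_const.mul (hg.div cu fun x hx => (hu0 x hx).ne'))
      (fun x hx => mul_pos hq0 (div_pos (hg0 x hx) (hu0 x hx))) h1 h2 (hv.mul hη)
      (fun x hx => by simp [h0 x hx])
    rw [← integral_const_mul, ← integral_const_mul, ← integral_sub iY (iM.const_mul 2),
      ← integral_add iYM iH, ← integral_const_mul]
    refine le_of_eq_of_le (integral_congr_ae (Filter.Eventually.of_forall fun x => ?_))
      (hst.trans_eq (integral_congr_ae (Filter.Eventually.of_forall fun x => ?_)))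
    · by_cases hx : x ∈ S
      · have := hv0 x (hSΩ hx)
        simp only; field_simp
      · simp [h0 x hx]
    · by_cases hx : x ∈ S
      · have hxΩ := hΩ.mem_nhds (hSΩ hx)
        have := hu0 x (hSΩ hx)
        have := hg0 x (hSΩ hx)
        simp only
        rw [lap_mul (hv.contDiffAt hxΩ) (hη.contDiffAt hxΩ),
          show lap v x = -g x by rw [← hgv x (hSΩ hx)]; ring,
          show v x * lap η x + 2 * gdot v η x + η x * -g x = h x - g x * η x by
            simp only [hh]; ring]
        field_simp
        ring
      · have : ∀ y ∉ S, v y * η y = 0 := fun y hy => by simp [h0 y hy]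
        simp [lap_eq_zero hS this hx, hh0 x hx, h0 x hx]
  have ener : ∫ x, f x * v x * η x ^ 2 = (∫ x, g x * u x * η x ^ 2) -
      2 * (∫ x, u x * η x * h x) - 2 * ∫ x, u x * v x * gdot η η x := by
    have gr := integral_mul_lap_comm hΩ hS hSΩ hu (g := fun x => v x * (η x * η x))
      (hv.mul (hη.mul hη)) (fun x hx => by simp [h0 x hx])
    rw [← integral_const_mul, ← integral_const_mul, ← integral_sub iY (iM.const_mul 2),
      ← integral_sub iYM (iT.const_mul 2), ← neg_inj, ← integral_neg,
      ← integral_neg]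
    refine (integral_congr_ae (Filter.Eventually.of_forall fun x => ?_)).trans
      (gr.symm.trans (integral_congr_ae (Filter.Eventually.of_forall fun x => ?_)))
    · by_cases hx : x ∈ S
      · rw [← hfu x (hSΩ hx)]; ring
      · simp [h0 x hx]
    · by_cases hx : x ∈ S
      · have hxΩ := hΩ.mem_nhds (hSΩ hx)
        have cη' := hη.contDiffAt hxΩ
        have dη := cη'.differentiableAt (by simp)
        simp only
        rw [lap_mul (hv.contDiffAt hxΩ) (cη'.mul cη'), lap_mul cη' cη', gdot_comm v,
          gdot_mul_left dη dη, gdot_comm η v,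
          show lap v x = -g x by rw [← hgv x (hSΩ hx)]; ring]
        simp only [hh]
        ring
      · have : ∀ y ∉ S, v y * (η y * η y) = 0 := fun y hy => by simp [h0 y hy]
        simp [lap_eq_zero hS this hx, hh0 x hx, h0 x hx, gdot_eq_zero η hS h0 hx]
  have cross : 2 * (∫ x, u x * η x * h x) ≤
      1 / 2 * (∫ x, g x * u x * η x ^ 2) + 2 * ∫ x, u x / g x * h x ^ 2 := by
    rw [← integral_const_mul, ← integral_const_mul, ← integral_const_mul,
      ← integral_add (iY.const_mul _) (iH.const_mul _)]
    refine integral_mono (iM.const_mul 2) ((iY.const_mul _).add (iH.const_mul _)) fun x => ?_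
    by_cases hx : x ∈ S
    · have hux := hu0 x (hSΩ hx)
      have hgx := hg0 x (hSΩ hx)
      have e : 1 / 2 * (g x * u x * η x ^ 2) + 2 * (u x / g x * h x ^ 2)
          - 2 * (u x * η x * h x) = u x / g x / 2 * (g x * η x - 2 * h x) ^ 2 := by
        field_simp; ring
      have : 0 ≤ u x / g x / 2 * (g x * η x - 2 * h x) ^ 2 := by positivity
      simp only
      linarith
    · simp [h0 x hx, hh0 x hx]
  have hH : ∫ x, u x / g x * h x ^ 2 ≤
      ∫ x, u x / g x * (8 * gdot v v x * gdot η η x + 2 * v x ^ 2 * lap η x ^ 2) := by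
    refine integral_mono iH iH' fun x => ?_
    by_cases hx : x ∈ S
    · have hux := hu0 x (hSΩ hx)
      have hgx := hg0 x (hSΩ hx)
      refine mul_le_mul_of_nonneg_left ?_ (by positivity)
      have := gdot_sq_le v η x
      simp only [hh]
      nlinarith [sq_nonneg (2 * gdot v η x - v x * lap η x)]
    · simp [hh0 x hx, gdot_eq_zero η hS h0 hx, lap_eq_zero hS h0 hx]
  have hT0 : 0 ≤ ∫ x, u x * v x * gdot η η x := integral_nonneg fun x => by
    by_cases hx : x ∈ S
    · have := hu0 x (hSΩ hx)
      have := hv0 x (hSΩ hx)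
      have := gdot_self_nonneg η x
      simp only [Pi.zero_apply]; positivity
    · simp [gdot_eq_zero η hS h0 hx]
  have hH0 : 0 ≤ ∫ x, u x / g x * h x ^ 2 := integral_nonneg fun x => by
    by_cases hx : x ∈ S
    · have := hu0 x (hSΩ hx)
      have := hg0 x (hSΩ hx)
      simp only [Pi.zero_apply]; positivity
    · simp [hh0 x hx]
  rw [integral_add iT iH']
  have eXY : ∫ x, (f x * v x + g x * u x) * η x ^ 2 =
      (∫ x, f x * v x * η x ^ 2) + ∫ x, g x * u x * η x ^ 2 := by
    rw [← integral_add iX iY]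
    exact integral_congr_ae (Filter.Eventually.of_forall fun x => by simp only; ring)
  rw [eXY]
  set IX := ∫ x, f x * v x * η x ^ 2
  set IY := ∫ x, g x * u x * η x ^ 2
  set IM := ∫ x, u x * η x * h x
  set IT := ∫ x, u x * v x * gdot η η x
  set IH := ∫ x, u x / g x * h x ^ 2
  have k0 : 0 < p * q - 1 := by linarith
  have st : p * q * IX ≤ IY - 2 * IM + IH := by
    have := mul_le_mul_of_nonneg_left stab hq0.le
    rw [← mul_assoc, ← mul_assoc, mul_one_div_cancel hq0.ne', one_mul] at this
    linarith
  have b1 : IX ≤ 2 / (p * q - 1) * (IT + IH) := by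
    rw [div_mul_eq_mul_div, le_div_iff₀ k0]
    nlinarith
  have b2 : IX + IY ≤ 3 * IX + 4 * (IT + IH) := by linarith
  have b3 : IX + IY ≤ (6 / (p * q - 1) + 4) * (IT + IH) := by
    have : (6 / (p * q - 1) + 4) * (IT + IH) =
      3 * (2 / (p * q - 1) * (IT + IH)) + 4 * (IT + IH) := by ring
    linarith
  refine b3.trans (mul_le_mul_of_nonneg_left (by linarith) (by positivity))

/-- A weighted Caccioppoli inequality. -/
lemma integral_gradient_le {f g χ D : Euc N → ℝ} {t s : ℝ} {U S : Set (Euc N)}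
    (ht : 0 < t) (hs0 : 0 ≤ s) (hs1 : s < 1) (hU : IsOpen U)
    (hS : IsCompact S) (hSU : S ⊆ U) (hf : ContDiffOn ℝ 2 f U) (hg : ContDiffOn ℝ 2 g U)
    (hf0 : ∀ x ∈ U, 0 < f x) (hg0 : ∀ x ∈ U, 0 < g x) (hgl : ∀ x ∈ U, lap g x ≤ 0)
    (hχ : ContDiffOn ℝ 2 χ U) (hχ0 : ∀ x, 0 ≤ χ x) (h0 : ∀ x ∉ S, χ x = 0)
    (hD : ContinuousOn D U) (hD0 : ∀ x ∉ S, D x = 0)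
    (hχD : ∀ x ∈ U, gdot χ χ x ≤ χ x * D x) (hlD : ∀ x ∈ U, |lap χ x| ≤ D x) :
    t * ∫ x, f x ^ (t - 1) * g x ^ s * gdot f f x * χ x ≤
      (∫ x, -lap f x * f x ^ t * g x ^ s * χ x) +
        1 / ((t + 1) * (1 - s)) * ∫ x, f x ^ (t + 1) * g x ^ s * D x := by
  have cr : ∀ r : ℝ, ContinuousOn (fun x => f x ^ r) U := fun r =>
    hf.continuousOn.rpow_const fun x hx => Or.inl (hf0 x hx).ne'
  have cgs : ContinuousOn (fun x => g x ^ s) U :=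
    hg.continuousOn.rpow_const fun x hx => Or.inl (hg0 x hx).ne'
  have Cf : ContDiffOn ℝ 2 (fun x => f x ^ (t + 1)) U :=
    hf.rpow_const_of_ne fun x hx => (hf0 x hx).ne'
  have Cg : ContDiffOn ℝ 2 (fun x => g x ^ s) U := hg.rpow_const_of_ne fun x hx => (hg0 x hx).ne'
  have Cgχ : ContDiffOn ℝ 2 (fun x => g x ^ s * χ x) U := Cg.mul hχ
  have hgχ0 : ∀ x ∉ S, g x ^ s * χ x = 0 := fun x hx => by simp [h0 x hx]
  have green := integral_mul_lap_comm hU hS hSU Cf Cgχ hgχ0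
  have clf := continuousOn_lap hU hf
  have clg := continuousOn_lap hU Cgχ
  have cff := continuousOn_gdot hU hf hf
  have i1 : Integrable fun x => f x ^ (t - 1) * g x ^ s * gdot f f x * χ x :=
    integrable_of_continuousOn hS (((((cr _).mul cgs).mul cff).mul hχ.continuousOn).mono hSU)
      fun x hx => by simp [h0 x hx]
  have i2 : Integrable fun x => -lap f x * f x ^ t * g x ^ s * χ x :=
    integrable_of_continuousOn hS ((((clf.neg.mul (cr _)).mul cgs).mul hχ.continuousOn).mono hSU)
      fun x hx => by simp [h0 x hx]
  have i3 : Integrable fun x => f x ^ (t + 1) * lap (fun x => g x ^ s * χ x) x :=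
    integrable_of_continuousOn hS (((cr _).mul clg).mono hSU)
      fun x hx => by simp [lap_eq_zero hS hgχ0 hx]
  have i4 : Integrable fun x => f x ^ (t + 1) * g x ^ s * D x :=
    integrable_of_continuousOn hS ((((cr _).mul cgs).mul hD).mono hSU)
      fun x hx => by simp [hD0 x hx]
  have e : ∫ x, lap (fun x => f x ^ (t + 1)) x * (g x ^ s * χ x) =
      (t + 1) * (t * (∫ x, f x ^ (t - 1) * g x ^ s * gdot f f x * χ x) -
        ∫ x, -lap f x * f x ^ t * g x ^ s * χ x) := by
    rw [← integral_const_mul, ← integral_sub (i1.const_mul t) i2, ← integral_const_mul]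
    refine integral_congr_ae (Filter.Eventually.of_forall fun x => ?_)
    by_cases hx : x ∈ S
    · simp only
      rw [lap_rpow (hf.contDiffAt (hU.mem_nhds (hSU hx))) (hf0 x (hSU hx)),
        show t + 1 - 1 = t by ring, show t + 1 - 2 = t - 1 by ring]
      ring
    · simp [h0 x hx]
  have b : ∫ x, f x ^ (t + 1) * lap (fun x => g x ^ s * χ x) x ≤
      1 / (1 - s) * ∫ x, f x ^ (t + 1) * g x ^ s * D x := by
    rw [← integral_const_mul]
    refine integral_mono i3 (i4.const_mul _) fun x => ?_
    by_cases hx : x ∈ S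
    · have hxU := hSU hx
      have cg := hg.contDiffAt (hU.mem_nhds hxU)
      have gp := hg0 x hxU
      have fp := hf0 x hxU
      have l := lap_mul (Cg.contDiffAt (hU.mem_nhds hxU)) (hχ.contDiffAt (hU.mem_nhds hxU))
      rw [lap_rpow cg gp, gdot_rpow_left (cg.differentiableAt (by simp)) gp] at l
      simp only
      rw [show 1 / (1 - s) * (f x ^ (t + 1) * g x ^ s * D x) =
        f x ^ (t + 1) * (g x ^ s * (1 / (1 - s) * D x)) by ring]
      refine mul_le_mul_of_nonneg_left ?_ (by positivity)
      rw [l]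
      have e1 : g x ^ (s - 1) = g x ^ s / g x := Real.rpow_sub_one gp.ne' s
      have e2 : g x ^ (s - 2) = g x ^ s / g x ^ 2 := by
        rw [show (2 : ℝ) = ((2 : ℕ) : ℝ) by norm_num, Real.rpow_sub_natCast gp.ne']
      rw [e1, e2]
      have hG : 0 < g x ^ s := by positivity
      set G := g x ^ s
      have h1s : 0 < 1 - s := by linarith
      have hc := hχ0 x
      have hd := hχD x hxU
      have hl := (abs_le.1 (hlD x hxU)).2
      have hDx : 0 ≤ D x := (abs_nonneg _).trans (hlD x hxU)
      have hgl' : χ x * (s * (G / g x) * lap g x) ≤ 0 :=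
        mul_nonpos_of_nonneg_of_nonpos hc
          (mul_nonpos_of_nonneg_of_nonpos (by positivity) (hgl x hxU))
      have gn := gdot_self_nonneg g x
      have young : 2 * gdot g χ x * g x ≤
          (1 - s) * χ x * gdot g g x + g x ^ 2 * D x / (1 - s) := by
        have cs := gdot_sq_le g χ x
        have hm : gdot g g x * gdot χ χ x ≤ gdot g g x * (χ x * D x) :=
          mul_le_mul_of_nonneg_left hd gn
        set A := (1 - s) * χ x * gdot g g x with hA
        set B := g x ^ 2 * D x / (1 - s) with hB
        have hA0 : 0 ≤ A := by positivity
        have hB0 : 0 ≤ B := by positivity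
        have hAB : A * B = g x ^ 2 * (gdot g g x * (χ x * D x)) := by
          rw [hA, hB]; field_simp
        refine abs_le_of_sq_le_sq' ?_ (by positivity) |>.2
        have : gdot g χ x ^ 2 * g x ^ 2 ≤ A * B := by
          rw [hAB]; nlinarith [sq_nonneg (g x)]
        nlinarith [sq_nonneg (A - B)]
      have y2 := mul_le_mul_of_nonneg_left young (show 0 ≤ s * G / g x ^ 2 by positivity)
      have e3 : s * G / g x ^ 2 * (2 * gdot g χ x * g x) = 2 * (s * (G / g x) * gdot g χ x) := by
        field_simp
      have e4 : s * G / g x ^ 2 * ((1 - s) * χ x * gdot g g x + g x ^ 2 * D x / (1 - s)) =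
          -(χ x * (s * (s - 1) * (G / g x ^ 2) * gdot g g x)) + G * (s / (1 - s) * D x) := by
        field_simp; ring
      have e5 : G * (1 / (1 - s) * D x) = G * D x + G * (s / (1 - s) * D x) := by
        field_simp; ring
      have y3 : G * lap χ x ≤ G * D x := mul_le_mul_of_nonneg_left hl hG.le
      rw [e3, e4] at y2
      rw [e5]
      linarith
    · simp [lap_eq_zero hS hgχ0 hx, hD0 x hx]
  rw [green, e] at b
  set I1 := ∫ x, f x ^ (t - 1) * g x ^ s * gdot f f x * χ x
  set I2 := ∫ x, -lap f x * f x ^ t * g x ^ s * χ x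
  set I3 := ∫ x, f x ^ (t + 1) * g x ^ s * D x
  have t1 : 0 < t + 1 := by linarith
  have : t * I1 - I2 ≤ 1 / (1 - s) * I3 / (t + 1) := by
    rw [le_div_iff₀ t1]; linarith
  have e6 : 1 / (1 - s) * I3 / (t + 1) = 1 / ((t + 1) * (1 - s)) * I3 := by
    have : 0 < 1 - s := by linarith
    field_simp
  linarith

/-! ### Cut-off functions -/

lemma pd_comp_smul (f : Euc N → ℝ) (c : ℝ) (i : Fin N) (x : Euc N) :
    pd i (fun y => f (c • y)) x = c * pd i f (c • x) := by
  simp [pd, fderiv_comp_smul]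

lemma gdot_comp_smul (f : Euc N → ℝ) (c : ℝ) (x : Euc N) :
    gdot (fun y => f (c • y)) (fun y => f (c • y)) x = c ^ 2 * gdot f f (c • x) := by
  simp only [gdot, Finset.mul_sum, pd_comp_smul]
  exact Finset.sum_congr rfl fun i _ => by ring

lemma lap_comp_smul {f : Euc N → ℝ} (hf : ContDiff ℝ 2 f) (c : ℝ) (x : Euc N) :
    lap (fun y => f (c • y)) x = c ^ 2 * lap f (c • x) := by
  have h2 : ContDiffAt ℝ 2 (fun y => f (c • y)) x := (hf.comp (contDiff_const_smul c)).contDiffAt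
  rw [lap_eq hf.contDiffAt, lap_eq h2, Finset.mul_sum]
  refine Finset.sum_congr rfl fun i _ => ?_
  rw [show pd i (fun y => f (c • y)) = fun y => c * pd i f (c • y) from
    funext fun y => pd_comp_smul f c i y]
  have hd : Differentiable ℝ fun y => pd i f (c • y) := fun y =>
    (differentiableAt_pd hf.contDiffAt i).comp y (differentiableAt_id.const_smul c)
  rw [pd_const_mul (hd x), pd_comp_smul]
  ring

/-- A smooth function equal to `1` on the ball of radius `R` and to `0` outside the ball of
radius `2 * R`. -/
def cut (R : ℝ) (x : Euc N) : ℝ := Real.smoothTransition (2 - ‖R⁻¹ • x‖ ^ 2)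

/-- A smooth bump supported in the annulus `R / 2 ≤ ‖x‖ ≤ 2 * R`. -/
def bump (R : ℝ) (x : Euc N) : ℝ := cut R x - cut (R / 2) x

/-- The closed annulus with radii `R / 2` and `2 * R`. -/
def ann (N : ℕ) (R : ℝ) : Set (Euc N) := {x | R / 2 ≤ ‖x‖ ∧ ‖x‖ ≤ 2 * R}

lemma isCompact_annulus (r R : ℝ) : IsCompact {x : Euc N | r ≤ ‖x‖ ∧ ‖x‖ ≤ R} := by
  have h : {x : Euc N | r ≤ ‖x‖ ∧ ‖x‖ ≤ R} = closedBall 0 R ∩ {x | r ≤ ‖x‖} := by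
    ext x; simp [and_comm]
  rw [h]
  exact (isCompact_closedBall 0 R).inter_right (isClosed_le continuous_const continuous_norm)

lemma isCompact_ann (R : ℝ) : IsCompact (ann N R) := isCompact_annulus _ _

lemma ann_subset {R : ℝ} (hR : 0 < R) : ann N R ⊆ {x | x ≠ 0} := fun x hx h => by
  have := hx.1
  rw [h, norm_zero] at this
  linarith

lemma isOpen_punctured : IsOpen {x : Euc N | x ≠ 0} := isOpen_ne

lemma cut_contDiff (R : ℝ) {n : ℕ∞} : ContDiff ℝ n (cut R : Euc N → ℝ) :=
  Real.smoothTransition.contDiff.comp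
    (contDiff_const.sub ((contDiff_const_smul R⁻¹).norm_sq ℝ))

lemma bump_contDiff (R : ℝ) {n : ℕ∞} : ContDiff ℝ n (bump R : Euc N → ℝ) :=
  (cut_contDiff R).sub (cut_contDiff (R / 2))

lemma cut_nonneg (R : ℝ) (x : Euc N) : 0 ≤ cut R x := Real.smoothTransition.nonneg _

lemma cut_le_one (R : ℝ) (x : Euc N) : cut R x ≤ 1 := Real.smoothTransition.le_one _

lemma cut_eq_one {R : ℝ} (hR : 0 < R) {x : Euc N} (hx : ‖x‖ ≤ R) : cut R x = 1 := by
  refine Real.smoothTransition.one_of_one_le ?_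
  have : ‖R⁻¹ • x‖ ≤ 1 := by
    rw [norm_smul, norm_inv, Real.norm_of_nonneg hR.le, inv_mul_le_iff₀ hR]; linarith
  nlinarith [norm_nonneg (R⁻¹ • x)]

lemma cut_eq_zero {R : ℝ} (hR : 0 < R) {x : Euc N} (hx : 2 * R ≤ ‖x‖) : cut R x = 0 := by
  refine Real.smoothTransition.zero_of_nonpos ?_
  have : 2 ≤ ‖R⁻¹ • x‖ := by
    rw [norm_smul, norm_inv, Real.norm_of_nonneg hR.le, le_inv_mul_iff₀ hR]; linarith
  nlinarith

lemma bump_eq_cut {R : ℝ} (hR : 0 < R) {x : Euc N} (hx : R ≤ ‖x‖) : bump R x = cut R x := by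
  rw [bump, cut_eq_zero (half_pos hR) (by linarith), sub_zero]

lemma bump_nonneg {R : ℝ} (hR : 0 < R) (x : Euc N) : 0 ≤ bump R x := by
  rcases le_total ‖x‖ R with h | h
  · rw [bump, cut_eq_one hR h]; linarith [cut_le_one (R / 2) x]
  · rw [bump_eq_cut hR h]; exact cut_nonneg R x

lemma bump_le_cut (R : ℝ) (x : Euc N) : bump R x ≤ cut R x := by
  rw [bump]; linarith [cut_nonneg (R / 2) x]

lemma bump_le_one (R : ℝ) (x : Euc N) : bump R x ≤ 1 := (bump_le_cut R x).trans (cut_le_one R x)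

lemma bump_eq_zero {R : ℝ} (hR : 0 < R) {x : Euc N} (hx : x ∉ ann N R) : bump R x = 0 := by
  simp only [ann, mem_ofPred_eq, not_and_or, not_le] at hx
  rcases hx with h | h
  · rw [bump, cut_eq_one hR (by linarith), cut_eq_one (half_pos hR) h.le, sub_self]
  · rw [bump_eq_cut hR (by linarith), cut_eq_zero hR h.le]

lemma bump_eq_comp {R : ℝ} : (bump R : Euc N → ℝ) = fun x => bump 1 (R⁻¹ • x) := by
  funext x
  simp only [bump, cut, smul_smul]
  congr 5 <;> ring_nf

lemma cut_eq_comp {R : ℝ} : (cut R : Euc N → ℝ) = fun x => cut 1 (R⁻¹ • x) := by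
  funext x
  simp [cut]

lemma exists_bound_gdot_lap {f : Euc N → ℝ} {S : Set (Euc N)} (hf : ContDiff ℝ 2 f)
    (hS : IsCompact S) (h0 : ∀ x ∉ S, f x = 0) :
    ∃ C, 0 < C ∧ ∀ x, gdot f f x ≤ C ∧ |lap f x| ≤ C := by
  obtain ⟨C1, h1⟩ := hS.exists_bound_of_continuousOn
    ((continuousOn_gdot isOpen_univ hf.contDiffOn hf.contDiffOn).mono (subset_univ S))
  obtain ⟨C2, h2⟩ := hS.exists_bound_of_continuousOn
    ((continuousOn_lap isOpen_univ hf.contDiffOn).mono (subset_univ S))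
  refine ⟨|C1| + |C2| + 1, by positivity, fun x => ?_⟩
  have n1 := le_abs_self C1
  have n2 := le_abs_self C2
  have p1 := abs_nonneg C1
  have p2 := abs_nonneg C2
  by_cases hx : x ∈ S
  · have a1 := (le_abs_self _).trans (h1 x hx)
    have a2 := h2 x hx
    rw [Real.norm_eq_abs] at a2
    exact ⟨by linarith, by linarith⟩
  · rw [gdot_eq_zero f hS h0 hx, lap_eq_zero hS h0 hx, abs_zero]
    exact ⟨by linarith, by linarith⟩

lemma exists_bound_cut_bump (N : ℕ) : ∃ C, 0 < C ∧ ∀ R : ℝ, 0 < R → ∀ x : Euc N,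
    gdot (cut R) (cut R) x ≤ C / R ^ 2 ∧ |lap (cut R) x| ≤ C / R ^ 2 ∧
    gdot (bump R) (bump R) x ≤ C / R ^ 2 ∧ |lap (bump R) x| ≤ C / R ^ 2 := by
  obtain ⟨C1, h1, b1⟩ := exists_bound_gdot_lap (f := (cut 1 : Euc N → ℝ)) (cut_contDiff 1 (n := 2))
    (isCompact_closedBall 0 2) fun x hx => by
      refine cut_eq_zero one_pos ?_
      simp only [mem_closedBall, dist_zero_right, not_le] at hx
      linarith
  obtain ⟨C2, h2, b2⟩ := exists_bound_gdot_lap (f := (bump 1 : Euc N → ℝ))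
    (bump_contDiff 1 (n := 2)) (isCompact_ann 1) fun x hx => bump_eq_zero one_pos hx
  refine ⟨C1 + C2, by positivity, fun R hR x => ?_⟩
  have hc : ContDiff ℝ 2 (cut 1 : Euc N → ℝ) := cut_contDiff 1 (n := 2)
  have hb : ContDiff ℝ 2 (bump 1 : Euc N → ℝ) := bump_contDiff 1 (n := 2)
  rw [cut_eq_comp (R := R), bump_eq_comp (R := R), gdot_comp_smul, gdot_comp_smul,
    lap_comp_smul hc, lap_comp_smul hb, abs_mul, abs_mul, abs_of_nonneg (sq_nonneg R⁻¹),
    inv_pow, div_eq_inv_mul]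
  have := b1 (R⁻¹ • x)
  have := b2 (R⁻¹ • x)
  refine ⟨?_, ?_, ?_, ?_⟩ <;> refine mul_le_mul_of_nonneg_left ?_ (by positivity) <;> linarith

lemma gdot_lap_cut_pow_eq_zero {R : ℝ} (hR : 0 < R) (n : ℕ) {x : Euc N} (hx : ‖x‖ < R) :
    gdot (fun y => cut R y ^ n) (fun y => cut R y ^ n) x = 0 ∧
      lap (fun y => cut R y ^ n) x = 0 := by
  have h : (fun y => cut R y ^ n) =ᶠ[nhds x] fun _ => (1 : ℝ) := by
    filter_upwards [(isOpen_lt continuous_norm continuous_const).mem_nhds hx] with y hy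
    rw [cut_eq_one hR (le_of_lt hy), one_pow]
  have h1 : ∀ y : Euc N, ∀ i, pd i (fun _ => (1 : ℝ)) y = 0 := fun y i => pd_const 1 i y
  constructor
  · simp [gdot, pd_congr h, h1]
  · rw [lap_congr ((cut_contDiff R (n := 2)).contDiffAt.pow n) h, lap_eq contDiffAt_const]
    refine Finset.sum_eq_zero fun i _ => ?_
    rw [show pd i (fun _ : Euc N => (1 : ℝ)) = fun _ => 0 from funext fun y => h1 y i, pd_const]

lemma abs_lap_pow_le {f : Euc N → ℝ} {x : Euc N} {M : ℝ} (hf : ContDiffAt ℝ 2 f x) (k : ℕ)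
    (h0 : 0 ≤ f x) (h1 : f x ≤ 1) (hg : gdot f f x ≤ M) (hl : |lap f x| ≤ M) :
    |lap (fun y => f y ^ (k + 2)) x| ≤ (k + 2) ^ 2 * M * f x ^ k := by
  have hM : 0 ≤ M := (abs_nonneg _).trans hl
  have hfk : f x ^ (k + 1) ≤ f x ^ k := pow_le_pow_of_le_one h0 h1 (Nat.le_succ k)
  have hp := pow_nonneg h0 k
  have gn := gdot_self_nonneg f x
  rw [lap_pow hf]
  refine (abs_add_le _ _).trans ?_
  rw [abs_mul, abs_of_nonneg (show 0 ≤ ((k : ℝ) + 2) * f x ^ (k + 1) by positivity),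
    abs_of_nonneg (show 0 ≤ ((k : ℝ) + 2) * (k + 1) * f x ^ k * gdot f f x by positivity)]
  have e1 : ((k : ℝ) + 2) * f x ^ (k + 1) * |lap f x| ≤ (k + 2) * f x ^ k * M := by gcongr
  have e2 : ((k : ℝ) + 2) * (k + 1) * f x ^ k * gdot f f x ≤ (k + 2) * (k + 1) * f x ^ k * M := by
    gcongr
  calc _ ≤ ((k : ℝ) + 2) * f x ^ k * M + (k + 2) * (k + 1) * f x ^ k * M := add_le_add e1 e2
    _ = _ := by ring

lemma gdot_pow_le {f : Euc N → ℝ} {x : Euc N} {M : ℝ} (hf : DifferentiableAt ℝ f x) (k : ℕ)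
    (hg : gdot f f x ≤ M) :
    gdot (fun y => f y ^ (k + 2)) (fun y => f y ^ (k + 2)) x ≤
      (k + 2) ^ 2 * M * f x ^ (2 * k + 2) := by
  rw [gdot_pow_self hf]
  have e : (((k + 2 : ℕ) : ℝ) * f x ^ (k + 2 - 1)) ^ 2 = (k + 2) ^ 2 * f x ^ (2 * k + 2) := by
    rw [show k + 2 - 1 = k + 1 by omega, mul_pow, ← pow_mul,
      show (k + 1) * 2 = 2 * k + 2 by ring]
    push_cast; ring
  have ep : 0 ≤ f x ^ (2 * k + 2) := by
    rw [show 2 * k + 2 = (k + 1) * 2 by ring, pow_mul]; positivity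
  rw [e]
  nlinarith [mul_le_mul_of_nonneg_left hg (show 0 ≤ ((k : ℝ) + 2) ^ 2 * f x ^ (2 * k + 2) by
    positivity)]

lemma exists_bound_pow (N k : ℕ) : ∃ C, 0 < C ∧ ∀ R : ℝ, 0 < R → ∀ x : Euc N,
    gdot (fun y => cut R y ^ (k + 2)) (fun y => cut R y ^ (k + 2)) x ≤
      C / R ^ 2 * bump R x ^ (2 * k + 2) ∧
    |lap (fun y => cut R y ^ (k + 2)) x| ≤ C / R ^ 2 * bump R x ^ k ∧
    gdot (fun y => bump R y ^ (k + 2)) (fun y => bump R y ^ (k + 2)) x ≤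
      bump R x ^ (k + 2) * (C / R ^ 2 * bump R x ^ k) ∧
    |lap (fun y => bump R y ^ (k + 2)) x| ≤ C / R ^ 2 * bump R x ^ k := by
  obtain ⟨C, hC, h⟩ := exists_bound_cut_bump N
  refine ⟨(k + 2) ^ 2 * C, by positivity, fun R hR x => ?_⟩
  obtain ⟨h1, h2, h3, h4⟩ := h R hR x
  have cc : ContDiffAt ℝ 2 (cut R) x := (cut_contDiff R (n := 2)).contDiffAt
  have cb : ContDiffAt ℝ 2 (bump R) x := (bump_contDiff R (n := 2)).contDiffAt
  have b0 := bump_nonneg hR x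
  rw [show ((k : ℝ) + 2) ^ 2 * C / R ^ 2 = (k + 2) ^ 2 * (C / R ^ 2) by ring]
  refine ⟨?_, ?_, ?_, abs_lap_pow_le cb k b0 (bump_le_one R x) h3 h4⟩
  · rcases lt_or_ge ‖x‖ R with hx | hx
    · rw [(gdot_lap_cut_pow_eq_zero hR _ hx).1]; positivity
    · rw [bump_eq_cut hR hx]
      exact gdot_pow_le (cc.differentiableAt (by simp)) k h1
  · rcases lt_or_ge ‖x‖ R with hx | hx
    · rw [(gdot_lap_cut_pow_eq_zero hR _ hx).2, abs_zero]; positivity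
    · rw [bump_eq_cut hR hx]
      exact abs_lap_pow_le cc k (cut_nonneg R x) (cut_le_one R x) h1 h2
  · refine (gdot_pow_le (cb.differentiableAt (by simp)) k h3).trans_eq ?_
    ring

lemma integral_bump {R : ℝ} (hR : 0 < R) :
    ∫ x : Euc N, bump R x = R ^ N * ∫ x : Euc N, bump 1 x := by
  rw [bump_eq_comp (R := R), Measure.integral_comp_inv_smul volume (fun x : Euc N => bump 1 x) R]
  simp [abs_of_pos hR]

lemma integrable_mul_bump {F : Euc N → ℝ} {R : ℝ} (hR : 0 < R)
    (hF : ContinuousOn F {x | x ≠ 0}) {j : ℕ} (hj : j ≠ 0) :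
    Integrable fun x => F x * bump R x ^ j :=
  integrable_of_continuousOn (isCompact_ann R)
    ((hF.mono (ann_subset hR)).mul ((bump_contDiff R (n := 0)).continuous.pow j).continuousOn)
    fun x hx => by simp [bump_eq_zero hR hx, hj]

/-! ### The Pohozaev identity -/

/-- The derivative in the radial direction. -/
def xd (f : Euc N → ℝ) (x : Euc N) : ℝ := ∑ j, x j * pd j f x

lemma contDiff_coord (j : Fin N) {n : WithTop ℕ∞} : ContDiff ℝ n fun y : Euc N => y j :=
  (EuclideanSpace.proj (𝕜 := ℝ) j).contDiff

lemma pd_coord (i j : Fin N) (x : Euc N) :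
    pd i (fun y : Euc N => y j) x = if i = j then 1 else 0 := by
  have : fderiv ℝ (fun y : Euc N => y j) x = EuclideanSpace.proj (𝕜 := ℝ) j :=
    (EuclideanSpace.proj (𝕜 := ℝ) j).fderiv
  rw [pd, this]
  simp [eq_comm]

lemma contDiffAt_xd {f : Euc N → ℝ} {x : Euc N} (hf : ContDiffAt ℝ 2 f x) :
    ContDiffAt ℝ 1 (xd f) x :=
  ContDiffAt.sum fun j _ => (contDiff_coord j).contDiffAt.mul (contDiffAt_pd hf j)

lemma contDiffAt_gdot {f g : Euc N → ℝ} {x : Euc N} (hf : ContDiffAt ℝ 2 f x)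
    (hg : ContDiffAt ℝ 2 g x) : ContDiffAt ℝ 1 (gdot f g) x :=
  ContDiffAt.sum fun j _ => (contDiffAt_pd hf j).mul (contDiffAt_pd hg j)

lemma pd_xd {f : Euc N → ℝ} {x : Euc N} (hf : ContDiffAt ℝ 2 f x) (i : Fin N) :
    pd i (xd f) x = pd i f x + ∑ j, x j * pd j (pd i f) x := by
  have hc : ∀ j, DifferentiableAt ℝ (fun y : Euc N => y j) x := fun j =>
    (contDiff_coord (n := 1) j).contDiffAt.differentiableAt (by simp)
  have e : xd f = fun y => ∑ j ∈ Finset.univ, (fun z : Euc N => z j * pd j f z) y := rfl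
  rw [e, pd_sum _ fun j _ => (hc j).fun_mul (differentiableAt_pd hf j)]
  have : ∀ j, pd i (fun z : Euc N => z j * pd j f z) x =
      x j * pd j (pd i f) x + pd j f x * if i = j then 1 else 0 := fun j => by
    rw [pd_mul (hc j) (differentiableAt_pd hf j), pd_coord, pd_comm hf]
  simp only [this, Finset.sum_add_distrib]
  simp [add_comm]

lemma pd_gdot {f g : Euc N → ℝ} {x : Euc N} (hf : ContDiffAt ℝ 2 f x) (hg : ContDiffAt ℝ 2 g x)
    (j : Fin N) : pd j (gdot f g) x =
      ∑ i, (pd i f x * pd j (pd i g) x + pd i g x * pd j (pd i f) x) := by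
  have e : gdot f g = fun y => ∑ i ∈ Finset.univ, (fun z => pd i f z * pd i g z) y := rfl
  rw [e, pd_sum _ fun i _ => (differentiableAt_pd hf i).fun_mul (differentiableAt_pd hg i)]
  exact Finset.sum_congr rfl fun i _ => pd_mul (differentiableAt_pd hf i) (differentiableAt_pd hg i) j

/-- The vector field of the Pohozaev identity. -/
def pohozaevField (u v Φ : Euc N → ℝ) (c d : ℝ) (i : Fin N) (x : Euc N) : ℝ :=
  pd i u x * xd v x + pd i v x * xd u x + x i * (Φ x - gdot u v x)
    + (c * (v x * pd i u x) + d * (u x * pd i v x))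

lemma contDiffAt_pohozaevField {u v Φ : Euc N → ℝ} {x : Euc N} (hu : ContDiffAt ℝ 2 u x)
    (hv : ContDiffAt ℝ 2 v x) (hΦ : ContDiffAt ℝ 1 Φ x) (c d : ℝ) (i : Fin N) :
    ContDiffAt ℝ 1 (pohozaevField u v Φ c d i) x :=
  ((((contDiffAt_pd hu i).mul (contDiffAt_xd hv)).add
    ((contDiffAt_pd hv i).mul (contDiffAt_xd hu))).add
    ((contDiff_coord i).contDiffAt.mul (hΦ.sub (contDiffAt_gdot hu hv)))).add
    ((contDiffAt_const.mul ((hv.of_le (by norm_num)).mul (contDiffAt_pd hu i))).add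
      (contDiffAt_const.mul ((hu.of_le (by norm_num)).mul (contDiffAt_pd hv i))))

lemma div_pohozaevField {u v Φ : Euc N → ℝ} {x : Euc N} (hu : ContDiffAt ℝ 2 u x)
    (hv : ContDiffAt ℝ 2 v x) (hΦ : ContDiffAt ℝ 1 Φ x) (c d : ℝ) (hcd : c + d = N - 2) :
    ∑ i, pd i (pohozaevField u v Φ c d i) x = lap u x * xd v x + lap v x * xd u x +
      N * Φ x + xd Φ x + c * (v x * lap u x) + d * (u x * lap v x) := by
  have du : DifferentiableAt ℝ u x := hu.differentiableAt (by simp)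
  have dv : DifferentiableAt ℝ v x := hv.differentiableAt (by simp)
  have dΦ : DifferentiableAt ℝ Φ x := hΦ.differentiableAt (by simp)
  have dg : DifferentiableAt ℝ (gdot u v) x := (contDiffAt_gdot hu hv).differentiableAt (by simp)
  have dxu : DifferentiableAt ℝ (xd u) x := (contDiffAt_xd hu).differentiableAt (by simp)
  have dxv : DifferentiableAt ℝ (xd v) x := (contDiffAt_xd hv).differentiableAt (by simp)
  have hc : ∀ j, DifferentiableAt ℝ (fun y : Euc N => y j) x := fun j =>
    (contDiff_coord (n := 1) j).contDiffAt.differentiableAt (by simp)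
  have hi : ∀ i, pd i (pohozaevField u v Φ c d i) x =
      xd v x * pd i (pd i u) x + xd u x * pd i (pd i v) x
      + (2 + c + d) * (pd i u x * pd i v x)
      + (pd i u x * ∑ j, x j * pd j (pd i v) x + pd i v x * ∑ j, x j * pd j (pd i u) x)
      + (Φ x - gdot u v x) + x i * pd i Φ x - x i * pd i (gdot u v) x
      + c * v x * pd i (pd i u) x + d * u x * pd i (pd i v) x := by
    intro i
    have dpu := differentiableAt_pd hu i
    have dpv := differentiableAt_pd hv i
    have e : pohozaevField u v Φ c d i = fun y =>
      (pd i u y * xd v y + pd i v y * xd u y + y i * (Φ y - gdot u v y))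
        + (c * (v y * pd i u y) + d * (u y * pd i v y)) := rfl
    rw [e, pd_add (((dpu.fun_mul dxv).fun_add (dpv.fun_mul dxu)).fun_add
        ((hc i).fun_mul (dΦ.fun_sub dg)))
        (((dv.fun_mul dpu).const_mul c).fun_add ((du.fun_mul dpv).const_mul d)),
      pd_add ((dpu.fun_mul dxv).fun_add (dpv.fun_mul dxu)) ((hc i).fun_mul (dΦ.fun_sub dg)),
      pd_add (dpu.fun_mul dxv) (dpv.fun_mul dxu),
      pd_add ((dv.fun_mul dpu).const_mul c) ((du.fun_mul dpv).const_mul d),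
      pd_const_mul (dv.fun_mul dpu), pd_const_mul (du.fun_mul dpv),
      pd_mul dpu dxv, pd_mul dpv dxu, pd_mul (hc i) (dΦ.fun_sub dg), pd_sub dΦ dg,
      pd_mul dv dpu, pd_mul du dpv, pd_coord, pd_xd hu, pd_xd hv]
    simp only [if_true]
    ring
  have hx : ∑ i, x i * pd i (gdot u v) x =
      ∑ i, (pd i u x * ∑ j, x j * pd j (pd i v) x + pd i v x * ∑ j, x j * pd j (pd i u) x) := by
    simp only [pd_gdot hu hv, Finset.mul_sum, ← Finset.sum_add_distrib]
    rw [Finset.sum_comm]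
    exact Finset.sum_congr rfl fun i _ => Finset.sum_congr rfl fun j _ => by ring
  simp only [hi, Finset.sum_add_distrib, Finset.sum_sub_distrib, ← Finset.mul_sum]
  rw [hx, lap_eq hu, lap_eq hv]
  have hg : ∑ i, pd i u x * pd i v x = gdot u v x := rfl
  have hΦ' : ∑ i, x i * pd i Φ x = xd Φ x := rfl
  simp only [hg, hΦ', Finset.sum_add_distrib, Finset.sum_const, Finset.card_univ,
    Fintype.card_fin, nsmul_eq_mul]
  linear_combination (gdot u v x) * hcd

lemma integral_pohozaev {u v f g Φ κ η : Euc N → ℝ} {c d : ℝ} {U S : Set (Euc N)}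
    (hU : IsOpen U) (hS : IsCompact S) (hSU : S ⊆ U) (hu : ContDiffOn ℝ 2 u U)
    (hv : ContDiffOn ℝ 2 v U) (hΦ : ContDiffOn ℝ 1 Φ U) (hη : ContDiffOn ℝ 1 η U)
    (h0 : ∀ x ∉ S, η x = 0) (hfu : ∀ x ∈ U, -lap u x = f x) (hgv : ∀ x ∈ U, -lap v x = g x)
    (hκ : ∀ x ∈ U, N * Φ x + xd Φ x = κ x + f x * xd v x + g x * xd u x)
    (hcd : c + d = N - 2) :
    ∫ x, (η x * (κ x - c * (f x * v x) - d * (g x * u x)) +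
      ∑ i, pd i η x * pohozaevField u v Φ c d i x) = 0 := by
  have hG : ∀ i, ContDiffOn ℝ 1 (pohozaevField u v Φ c d i) U := fun i x hx =>
    (contDiffAt_pohozaevField (hu.contDiffAt (hU.mem_nhds hx)) (hv.contDiffAt (hU.mem_nhds hx))
      (hΦ.contDiffAt (hU.mem_nhds hx)) c d i).contDiffWithinAt
  rw [← integral_div_eq_zero (F := fun i x => η x * pohozaevField u v Φ c d i x) hU hS hSU
    (fun i => hη.mul (hG i)) (fun i x hx => by simp [h0 x hx])]
  refine integral_congr_ae (Filter.Eventually.of_forall fun x => ?_)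
  by_cases hx : x ∈ S
  · have hxU := hU.mem_nhds (hSU hx)
    have hdiv := div_pohozaevField (hu.contDiffAt hxU) (hv.contDiffAt hxU) (hΦ.contDiffAt hxU)
      c d hcd
    have hm : ∀ i, pd i (fun x => η x * pohozaevField u v Φ c d i x) x =
        η x * pd i (pohozaevField u v Φ c d i) x + pohozaevField u v Φ c d i x * pd i η x :=
      fun i => pd_mul ((hη.contDiffAt hxU).differentiableAt (by simp))
        (((hG i).contDiffAt hxU).differentiableAt (by simp)) i
    simp only [hm, Finset.sum_add_distrib, ← Finset.mul_sum, hdiv]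
    rw [show lap u x = -f x by rw [← hfu x (hSU hx)]; ring,
      show lap v x = -g x by rw [← hgv x (hSU hx)]; ring]
    have e : ∑ i, pohozaevField u v Φ c d i x * pd i η x =
        ∑ i, pd i η x * pohozaevField u v Φ c d i x :=
      Finset.sum_congr rfl fun i _ => mul_comm _ _
    rw [e]
    linear_combination (-η x) * hκ x (hSU hx)
  · have : ∀ i : Fin N, pd i (fun y => η y * pohozaevField u v Φ c d i y) x = 0 := fun i =>
      pd_eq_zero hS (fun y hy => by simp [h0 y hy]) i hx
    simp [this, h0 x hx, pd_eq_zero hS h0 _ hx]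

/-! ### Weighted Young inequalities -/

lemma young_three {x y z α β γ : ℝ} (hx : 0 ≤ x) (hy : 0 ≤ y) (hz : 0 ≤ z) (hα : 0 ≤ α)
    (hβ : 0 ≤ β) (hγ : 0 ≤ γ) (h : α + β + γ = 1) : x ^ α * y ^ β * z ^ γ ≤ x + y + z := by
  refine (Real.geom_mean_le_arith_mean3_weighted hα hβ hγ hx hy hz h).trans ?_
  nlinarith

lemma young_monomial {R u v p q a b e α β γ r s t : ℝ} (hR : 0 < R) (hu : 0 < u) (hv : 0 < v)
    (hα : 0 ≤ α) (hβ : 0 ≤ β) (hγ : 0 ≤ γ) (h : α + β + γ = 1)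
    (hr : r = a * α + b * β + e * γ) (hs : s = (p + 1) * α) (ht : t = (q + 1) * β) :
    R ^ r * v ^ s * u ^ t ≤ R ^ a * v ^ (p + 1) + R ^ b * u ^ (q + 1) + R ^ e := by
  refine le_trans (le_of_eq ?_) (young_three (x := R ^ a * v ^ (p + 1)) (y := R ^ b * u ^ (q + 1))
    (z := R ^ e) (by positivity) (by positivity) (by positivity) hα hβ hγ h)
  rw [Real.mul_rpow (by positivity) (by positivity), Real.mul_rpow (by positivity) (by positivity),
    ← Real.rpow_mul hR.le, ← Real.rpow_mul hv.le, ← Real.rpow_mul hR.le, ← Real.rpow_mul hu.le,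
    ← Real.rpow_mul hR.le, hr, hs, ht, Real.rpow_add hR, Real.rpow_add hR]
  ring

lemma young_monomial_eps {R u v p q a b e α β γ r s t ε ω : ℝ} {n m : ℕ} (hR : 0 < R)
    (hu : 0 < u) (hv : 0 < v) (hα : 0 ≤ α) (hβ : 0 ≤ β) (hγ : 0 < γ) (h : α + β + γ = 1)
    (hr : r = a * α + b * β + e * γ) (hs : s = (p + 1) * α) (ht : t = (q + 1) * β)
    (hε : 0 < ε) (hω0 : 0 ≤ ω) (hω1 : ω ≤ 1) (hn : n ≠ 0) (hm : m * (1 - γ) + γ ≤ n) :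
    R ^ r * v ^ s * u ^ t * ω ^ n ≤ ε * (R ^ a * v ^ (p + 1) + R ^ b * u ^ (q + 1)) * ω ^ m +
      ε ^ (-(1 - γ) / γ) * (R ^ e * ω) := by
  rcases hω0.eq_or_lt with rfl | hω
  · rw [zero_pow hn, mul_zero]; positivity
  set x := R ^ a * v ^ (p + 1) with hx
  set y := R ^ b * u ^ (q + 1) with hy
  have hx0 : 0 < x := by positivity
  have hy0 : 0 < y := by positivity
  have hz0 : 0 < R ^ e := by positivity
  have e1 : R ^ r * v ^ s * u ^ t = x ^ α * y ^ β * (R ^ e) ^ γ := by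
    rw [hx, hy, Real.mul_rpow (by positivity) (by positivity),
      Real.mul_rpow (by positivity) (by positivity), ← Real.rpow_mul hR.le, ← Real.rpow_mul hv.le,
      ← Real.rpow_mul hR.le, ← Real.rpow_mul hu.le, ← Real.rpow_mul hR.le, hr, hs, ht,
      Real.rpow_add hR, Real.rpow_add hR]
    ring
  clear_value x y
  have key := young_three (x := ε * x * ω ^ m) (y := ε * y * ω ^ m)
    (z := ε ^ (-(1 - γ) / γ) * (R ^ e * ω)) (by positivity) (by positivity) (by positivity)
    hα hβ hγ.le h
  have e2 : (ε * x * ω ^ m) ^ α * (ε * y * ω ^ m) ^ β * (ε ^ (-(1 - γ) / γ) * (R ^ e * ω)) ^ γ =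
      x ^ α * y ^ β * (R ^ e) ^ γ * ω ^ (m * (1 - γ) + γ) := by
    rw [Real.mul_rpow (by positivity) (by positivity), Real.mul_rpow (by positivity) (by positivity),
      Real.mul_rpow (by positivity) (by positivity), Real.mul_rpow (by positivity) (by positivity),
      Real.mul_rpow (by positivity) (by positivity), Real.mul_rpow (by positivity) (by positivity),
      ← Real.rpow_mul hε.le, div_mul_cancel₀ _ hγ.ne', ← Real.rpow_natCast, ← Real.rpow_mul hω.le,
      ← Real.rpow_mul hω.le]
    have e3 : ε ^ α * ε ^ β * ε ^ (-(1 - γ)) = 1 := by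
      rw [← Real.rpow_add hε, ← Real.rpow_add hε, show α + β + -(1 - γ) = 0 by linarith,
        Real.rpow_zero]
    have e4 : ω ^ (m * α) * ω ^ (m * β) * ω ^ γ = ω ^ (m * (1 - γ) + γ) := by
      rw [← Real.rpow_add hω, ← Real.rpow_add hω, ← h]
      congr 1; ring
    rw [← e4]
    linear_combination (x ^ α * y ^ β * (R ^ e) ^ γ * ω ^ (m * α) * ω ^ (m * β) * ω ^ γ) * e3
  rw [e2] at key
  have e5 : ω ^ n ≤ ω ^ (m * (1 - γ) + γ) := by
    rw [← Real.rpow_natCast]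
    exact Real.rpow_le_rpow_of_exponent_ge hω hω1 hm
  rw [e1]
  calc _ ≤ x ^ α * y ^ β * (R ^ e) ^ γ * ω ^ (m * (1 - γ) + γ) := by gcongr
    _ ≤ _ := key
    _ = _ := by ring

/-! ### Positive solutions -/

/-- The nonlinearity `|x| ^ a * v ^ p`. -/
def src (a p : ℝ) (v : Euc N → ℝ) (x : Euc N) : ℝ := ‖x‖ ^ a * v x ^ p

/-- The energy density `|x| ^ a * v ^ (p + 1) + |x| ^ b * u ^ (q + 1)`. -/
def dens (p q a b : ℝ) (u v : Euc N → ℝ) (x : Euc N) : ℝ :=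
  src a p v x * v x + src b q u x * u x

/-- Positive solutions of the Hénon–Lane–Emden system. -/
structure PosSol (p q a b : ℝ) (u v : Euc N → ℝ) : Prop where
  hu : ContDiffOn ℝ 2 u {x | x ≠ 0}
  hv : ContDiffOn ℝ 2 v {x | x ≠ 0}
  cu : Continuous u
  cv : Continuous v
  u0 : ∀ x, 0 < u x
  v0 : ∀ x, 0 < v x
  eu : ∀ x, x ≠ 0 → -lap u x = src a p v x
  ev : ∀ x, x ≠ 0 → -lap v x = src b q u x

lemma abs_rpow_sub_one_mul {t : ℝ} (ht : 0 < t) (p : ℝ) : |t| ^ (p - 1) * t = t ^ p := by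
  rw [abs_of_pos ht, Real.rpow_sub_one ht.ne', div_mul_cancel₀ _ ht.ne']

lemma PosSol.of_isHLESol {p q a b : ℝ} {u v : Euc N → ℝ} (h : IsHLESol p q a b u v)
    (hu : ∀ x, 0 < u x) (hv : ∀ x, 0 < v x) : PosSol p q a b u v := by
  obtain ⟨h1, h2, h3, h4, h5, h6⟩ := h
  refine ⟨h1, h2, h3, h4, hu, hv, fun x hx => ?_, fun x hx => ?_⟩
  · rw [h5 x hx, abs_rpow_sub_one_mul (hv x), src]
  · rw [h6 x hx, abs_rpow_sub_one_mul (hu x), src]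

lemma src_pos {a p : ℝ} {v : Euc N → ℝ} (hv : ∀ x, 0 < v x) {x : Euc N} (hx : x ≠ 0) :
    0 < src a p v x :=
  mul_pos (Real.rpow_pos_of_pos (norm_pos_iff.2 hx) a) (Real.rpow_pos_of_pos (hv x) p)

lemma src_nonneg {a p : ℝ} {v : Euc N → ℝ} (hv : ∀ x, 0 < v x) (x : Euc N) : 0 ≤ src a p v x :=
  mul_nonneg (Real.rpow_nonneg (norm_nonneg x) a) (Real.rpow_nonneg (hv x).le p)

lemma continuous_rpow {v : Euc N → ℝ} (cv : Continuous v) (hv : ∀ x, 0 < v x) (p : ℝ) :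
    Continuous fun x => v x ^ p :=
  cv.rpow_const fun x => Or.inl (hv x).ne'

lemma continuousOn_norm_rpow (a : ℝ) : ContinuousOn (fun x : Euc N => ‖x‖ ^ a) {x | x ≠ 0} :=
  continuous_norm.continuousOn.rpow_const fun _ hx => Or.inl (norm_ne_zero_iff.2 hx)

lemma continuousOn_src {v : Euc N → ℝ} (cv : Continuous v) (hv : ∀ x, 0 < v x) (a p : ℝ) :
    ContinuousOn (src a p v) {x | x ≠ 0} :=
  (continuousOn_norm_rpow a).mul (continuous_rpow cv hv p).continuousOn

lemma norm_rpow_le {R : ℝ} (hR : 0 < R) {x : Euc N} (hx : x ∈ ann N R) (a : ℝ) :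
    ‖x‖ ^ a ≤ 2 ^ |a| * R ^ a ∧ R ^ a ≤ 2 ^ |a| * ‖x‖ ^ a := by
  have hx0 : 0 < ‖x‖ := (half_pos hR).trans_le hx.1
  have key : ∀ s t : ℝ, 0 < s → 0 < t → s ≤ 2 * t → t ≤ 2 * s → s ^ a ≤ 2 ^ |a| * t ^ a := by
    intro s t hs ht h1 h2
    rcases le_total 0 a with h | h
    · rw [abs_of_nonneg h, ← Real.mul_rpow (by norm_num) ht.le]
      exact Real.rpow_le_rpow hs.le h1 h
    · rw [abs_of_nonpos h, Real.rpow_neg (by norm_num), ← Real.inv_rpow (by norm_num),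
        ← Real.mul_rpow (by norm_num) ht.le]
      exact Real.rpow_le_rpow_of_nonpos (by positivity) (by linarith) h
  exact ⟨key _ _ hx0 hR hx.2 (by linarith [hx.1]), key _ _ hR hx0 (by linarith [hx.1]) hx.2⟩

namespace PosSol

variable {p q a b : ℝ} {u v : Euc N → ℝ}

lemma symm (h : PosSol p q a b u v) : PosSol q p b a v u :=
  ⟨h.hv, h.hu, h.cv, h.cu, h.v0, h.u0, h.ev, h.eu⟩

lemma continuousOn_dens (h : PosSol p q a b u v) : ContinuousOn (dens p q a b u v) {x | x ≠ 0} :=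
  ((continuousOn_src h.cv h.v0 a p).mul h.cv.continuousOn).add
    ((continuousOn_src h.cu h.u0 b q).mul h.cu.continuousOn)

lemma dens_nonneg (h : PosSol p q a b u v) (x : Euc N) : 0 ≤ dens p q a b u v x :=
  add_nonneg (mul_nonneg (src_nonneg h.v0 x) (h.v0 x).le)
    (mul_nonneg (src_nonneg h.u0 x) (h.u0 x).le)

lemma dens_pos (h : PosSol p q a b u v) {x : Euc N} (hx : x ≠ 0) : 0 < dens p q a b u v x :=
  add_pos (mul_pos (src_pos h.v0 hx) (h.v0 x)) (mul_pos (src_pos h.u0 hx) (h.u0 x))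

lemma dens_eq (h : PosSol p q a b u v) (x : Euc N) :
    dens p q a b u v x = ‖x‖ ^ a * v x ^ (p + 1) + ‖x‖ ^ b * u x ^ (q + 1) := by
  rw [dens, src, src, Real.rpow_add_one (h.v0 x).ne', Real.rpow_add_one (h.u0 x).ne']
  ring

lemma monomials_le_dens (h : PosSol p q a b u v) {R : ℝ} (hR : 0 < R) {x : Euc N}
    (hx : x ∈ ann N R) : R ^ a * v x ^ (p + 1) + R ^ b * u x ^ (q + 1) ≤
      2 ^ (|a| + |b|) * dens p q a b u v x := by
  have h1 : (1 : ℝ) ≤ 2 ^ |a| := Real.one_le_rpow (by norm_num) (abs_nonneg a)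
  have h2 : (1 : ℝ) ≤ 2 ^ |b| := Real.one_le_rpow (by norm_num) (abs_nonneg b)
  have hv := Real.rpow_pos_of_pos (h.v0 x) (p + 1)
  have hu := Real.rpow_pos_of_pos (h.u0 x) (q + 1)
  rw [h.dens_eq, Real.rpow_add (show (0 : ℝ) < 2 by norm_num), mul_add]
  refine add_le_add ?_ ?_
  · calc R ^ a * v x ^ (p + 1) ≤ (2 ^ |a| * ‖x‖ ^ a) * v x ^ (p + 1) := by
          gcongr; exact (norm_rpow_le hR hx a).2
      _ ≤ (2 ^ |a| * 2 ^ |b| * ‖x‖ ^ a) * v x ^ (p + 1) := by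
          gcongr; exact le_mul_of_one_le_right (by positivity) h2
      _ = _ := by ring
  · calc R ^ b * u x ^ (q + 1) ≤ (2 ^ |b| * ‖x‖ ^ b) * u x ^ (q + 1) := by
          gcongr; exact (norm_rpow_le hR hx b).2
      _ ≤ (2 ^ |a| * 2 ^ |b| * ‖x‖ ^ b) * u x ^ (q + 1) := by
          gcongr; exact le_mul_of_one_le_left (by positivity) h1
      _ = _ := by ring

end PosSol

/-! ### The energy estimate -/

/-- The right-hand side of the energy estimate obtained from stability. -/
def stabDens (u v g η : Euc N → ℝ) (x : Euc N) : ℝ :=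
  u x * v x * gdot η η x + u x / g x * (8 * gdot v v x * gdot η η x + 2 * v x ^ 2 * lap η x ^ 2)

lemma stabDens_sub_le {u v g η θ : Euc N → ℝ} {x : Euc N} (hu : 0 < u x) (hv : 0 < v x)
    (hg : 0 < g x) (hη : ContDiffAt ℝ 2 η x) (hθ : ContDiffAt ℝ 2 θ x) :
    stabDens u v g (fun y => η y - θ y) x ≤ 2 * stabDens u v g η x + 2 * stabDens u v g θ x := by
  have h1 := gdot_sub_self_le (hη.differentiableAt (by simp)) (hθ.differentiableAt (by simp))
  have h2 : lap (fun y => η y - θ y) x ^ 2 ≤ 2 * lap η x ^ 2 + 2 * lap θ x ^ 2 := by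
    rw [lap_sub hη hθ]
    nlinarith [sq_nonneg (lap η x + lap θ x)]
  have hvv := gdot_self_nonneg v x
  calc stabDens u v g (fun y => η y - θ y) x
      ≤ u x * v x * (2 * gdot η η x + 2 * gdot θ θ x) +
        u x / g x * (8 * gdot v v x * (2 * gdot η η x + 2 * gdot θ θ x) +
          2 * v x ^ 2 * (2 * lap η x ^ 2 + 2 * lap θ x ^ 2)) := by
        rw [stabDens]; gcongr
    _ = _ := by rw [stabDens, stabDens]; ring

namespace PosSol

variable {p q a b : ℝ} {u v : Euc N → ℝ}

lemma lap_nonpos (h : PosSol p q a b u v) {x : Euc N} (hx : x ≠ 0) : lap u x ≤ 0 := by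
  have := src_pos (a := a) (p := p) h.v0 hx
  linarith [h.eu x hx]

lemma integral_gradient_bound (h : PosSol p q a b u v) (hq0 : 0 < q) (hq1 : q < 1) {k : ℕ}
    (hk : k ≠ 0) : ∃ C, 0 < C ∧ ∀ R : ℝ, 0 < R →
    ∫ x, u x ^ (1 - q) * gdot v v x * bump R x ^ (2 * k + 2) ≤
      C * (R ^ b * (∫ x, u x * v x * bump R x ^ (2 * k)) +
        1 / R ^ 2 * ∫ x, u x ^ (1 - q) * v x ^ 2 * bump R x ^ (2 * k)) := by
  obtain ⟨C, hC, hb⟩ := exists_bound_pow N (2 * k)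
  refine ⟨2 ^ |b| + C / (2 * q), by positivity, fun R hR => ?_⟩
  have hU := isOpen_punctured (N := N)
  have hbc : ContDiff ℝ 2 (bump R : Euc N → ℝ) := bump_contDiff R (n := 2)
  have key := integral_gradient_le (f := v) (g := u) (χ := fun x => bump R x ^ (2 * k + 2))
    (D := fun x => C / R ^ 2 * bump R x ^ (2 * k)) (t := 1) (s := 1 - q) one_pos (by linarith)
    (by linarith) hU (isCompact_ann R) (ann_subset hR) h.hv h.hu (fun x _ => h.v0 x)
    (fun x _ => h.u0 x) (fun x hx => h.lap_nonpos hx) (hbc.pow _).contDiffOn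
    (fun x => pow_nonneg (bump_nonneg hR x) _) (fun x hx => by simp [bump_eq_zero hR hx])
    (continuous_const.mul (hbc.continuous.pow _)).continuousOn
    (fun x hx => by simp [bump_eq_zero hR hx, hk]) (fun x _ => (hb R hR x).2.2.1)
    (fun x _ => (hb R hR x).2.2.2)
  simp only [sub_self, Real.rpow_zero, one_mul, Real.rpow_one, one_add_one_eq_two,
    Real.rpow_two, sub_sub_cancel] at key
  refine key.trans ?_
  have cr := (continuous_rpow h.cu h.u0 (1 - q)).continuousOn (s := {x | x ≠ 0})
  have i1 : Integrable fun x => u x * v x * bump R x ^ (2 * k) :=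
    integrable_mul_bump hR (h.cu.mul h.cv).continuousOn (by simp [hk])
  have i2 : Integrable fun x => -lap v x * v x * u x ^ (1 - q) * bump R x ^ (2 * k + 2) :=
    integrable_mul_bump hR (((continuousOn_lap hU h.hv).neg.mul h.cv.continuousOn).mul cr)
      (by simp)
  have e1 : ∫ x, -lap v x * v x * u x ^ (1 - q) * bump R x ^ (2 * k + 2) ≤
      ∫ x, 2 ^ |b| * R ^ b * (u x * v x * bump R x ^ (2 * k)) := by
    refine integral_mono i2 (i1.const_mul _) fun x => ?_
    by_cases hx : x ∈ ann N R
    · have hx0 : x ≠ 0 := ann_subset hR hx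
      have hu := h.u0 x
      have hv := h.v0 x
      have hω := bump_nonneg hR x
      have e : u x ^ q * u x ^ (1 - q) = u x := by
        rw [← Real.rpow_add hu, add_sub_cancel, Real.rpow_one]
      simp only [h.ev x hx0, src]
      calc ‖x‖ ^ b * u x ^ q * v x * u x ^ (1 - q) * bump R x ^ (2 * k + 2)
          = ‖x‖ ^ b * (v x * (u x ^ q * u x ^ (1 - q)) * bump R x ^ (2 * k + 2)) := by ring
        _ ≤ (2 ^ |b| * R ^ b) * (v x * (u x ^ q * u x ^ (1 - q)) * bump R x ^ (2 * k)) := by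
          have := pow_le_pow_of_le_one hω (bump_le_one R x) (show 2 * k ≤ 2 * k + 2 by omega)
          gcongr
          exact (norm_rpow_le hR hx b).1
        _ = _ := by rw [e]; ring
    · simp [bump_eq_zero hR hx, hk]
  have e2 : ∫ x, v x ^ 2 * u x ^ (1 - q) * (C / R ^ 2 * bump R x ^ (2 * k)) =
      C / R ^ 2 * ∫ x, u x ^ (1 - q) * v x ^ 2 * bump R x ^ (2 * k) := by
    rw [← integral_const_mul]
    exact integral_congr_ae (Filter.Eventually.of_forall fun x => by ring)
  rw [integral_const_mul] at e1
  rw [e2]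
  set I1 := ∫ x, u x * v x * bump R x ^ (2 * k) with hI1
  set I3 := ∫ x, u x ^ (1 - q) * v x ^ 2 * bump R x ^ (2 * k) with hI3
  have p1 : 0 ≤ I1 := integral_nonneg fun x => mul_nonneg (mul_nonneg (h.u0 x).le (h.v0 x).le)
    (pow_nonneg (bump_nonneg hR x) _)
  have p3 : 0 ≤ I3 := integral_nonneg fun x => mul_nonneg
    (mul_nonneg (Real.rpow_nonneg (h.u0 x).le _) (sq_nonneg _)) (pow_nonneg (bump_nonneg hR x) _)
  calc _ ≤ 2 ^ |b| * R ^ b * I1 + 1 / (2 * q) * (C / R ^ 2 * I3) := by gcongr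
    _ = 2 ^ |b| * (R ^ b * I1) + C / (2 * q) * (1 / R ^ 2 * I3) := by ring
    _ ≤ (2 ^ |b| + C / (2 * q)) * (R ^ b * I1) + (2 ^ |b| + C / (2 * q)) * (1 / R ^ 2 * I3) := by
      gcongr
      · exact le_add_of_nonneg_right (by positivity)
      · exact le_add_of_nonneg_left (by positivity)
    _ = _ := by ring

lemma integral_stabDens_bound (h : PosSol p q a b u v) (hq0 : 0 < q) (hq1 : q < 1) {k : ℕ}
    (hk : k ≠ 0) : ∃ C, 0 < C ∧ ∀ R : ℝ, 0 < R →
    Integrable (stabDens u v (src b q u) fun y => cut R y ^ (k + 2)) ∧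
    ∫ x, stabDens u v (src b q u) (fun y => cut R y ^ (k + 2)) x ≤
      C * ((∫ x, R ^ (-2 : ℝ) * v x ^ (1 : ℝ) * u x ^ (1 : ℝ) * bump R x ^ (2 * k)) +
        ∫ x, R ^ (-b - 4) * v x ^ (2 : ℝ) * u x ^ (1 - q) * bump R x ^ (2 * k)) := by
  obtain ⟨C1, hC1, hb⟩ := exists_bound_pow N k
  obtain ⟨C2, hC2, hg⟩ := h.integral_gradient_bound hq0 hq1 hk
  set A : ℝ := 2 ^ |b| with hA
  have hA0 : 0 < A := by positivity
  refine ⟨C1 + 8 * A * C1 * C2 + 2 * A * C1 ^ 2, by positivity, fun R hR => ?_⟩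
  have hU := isOpen_punctured (N := N)
  have hc : ContDiff ℝ 2 (fun y : Euc N => cut R y ^ (k + 2)) := (cut_contDiff R (n := 2)).pow _
  have hgl : ∀ x ∉ ann N R, gdot (fun y => cut R y ^ (k + 2)) (fun y => cut R y ^ (k + 2)) x = 0 ∧
      lap (fun y => cut R y ^ (k + 2)) x = 0 := by
    intro x hx
    obtain ⟨b1, b2, -⟩ := hb R hR x
    rw [bump_eq_zero hR hx] at b1 b2
    simp only [ne_eq, hk, not_false_eq_true, zero_pow, mul_zero, Nat.add_eq_zero_iff, mul_eq_zero,
      OfNat.ofNat_ne_zero, or_self, and_self] at b1 b2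
    exact ⟨le_antisymm b1 (gdot_self_nonneg _ _), abs_eq_zero.1 (le_antisymm b2 (abs_nonneg _))⟩
  have cgv := continuousOn_gdot hU h.hv h.hv
  have cr := (continuous_rpow h.cu h.u0 (1 - q)).continuousOn (s := {x | x ≠ 0})
  have cT : ContinuousOn (stabDens u v (src b q u) fun y => cut R y ^ (k + 2)) {x | x ≠ 0} :=
    ((h.cu.mul h.cv).continuousOn.mul (continuousOn_gdot hU hc.contDiffOn hc.contDiffOn)).add
      ((h.cu.continuousOn.div (continuousOn_src h.cu h.u0 b q) fun x hx =>
        (src_pos h.u0 hx).ne').mul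
        (((continuousOn_const.mul cgv).mul (continuousOn_gdot hU hc.contDiffOn hc.contDiffOn)).add
          ((continuousOn_const.mul (h.cv.continuousOn.pow 2)).mul
            ((continuousOn_lap hU hc.contDiffOn).pow 2))))
  have iT := integrable_of_continuousOn (isCompact_ann R) (cT.mono (ann_subset hR)) fun x hx => by
    simp [stabDens, hgl x hx]
  refine ⟨iT, ?_⟩
  have i1 : Integrable fun x => u x * v x * bump R x ^ (2 * k) :=
    integrable_mul_bump hR (h.cu.mul h.cv).continuousOn (by simp [hk])
  have i2 : Integrable fun x => u x ^ (1 - q) * gdot v v x * bump R x ^ (2 * k + 2) :=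
    integrable_mul_bump hR (cr.mul cgv) (by simp)
  have i3 : Integrable fun x => u x ^ (1 - q) * v x ^ 2 * bump R x ^ (2 * k) :=
    integrable_mul_bump hR (cr.mul (h.cv.continuousOn.pow 2)) (by simp [hk])
  have hgR := hg R hR
  set B := R ^ (-b) with hB
  have hB0 : 0 < B := by positivity
  have hBb : B * R ^ b = 1 := by rw [hB, ← Real.rpow_add hR, neg_add_cancel, Real.rpow_zero]
  have hR2 : R ^ (-2 : ℝ) = 1 / R ^ 2 := by
    rw [Real.rpow_neg hR.le, Real.rpow_two, one_div]
  have hR4 : R ^ (-b - 4) = B / R ^ 4 := by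
    rw [Real.rpow_sub hR, ← hB]; norm_cast
  have ineq : ∫ x, stabDens u v (src b q u) (fun y => cut R y ^ (k + 2)) x ≤
      ∫ x, (C1 / R ^ 2 * (u x * v x * bump R x ^ (2 * k)) +
        8 * A * C1 * B / R ^ 2 * (u x ^ (1 - q) * gdot v v x * bump R x ^ (2 * k + 2)) +
        2 * A * C1 ^ 2 * B / R ^ 4 * (u x ^ (1 - q) * v x ^ 2 * bump R x ^ (2 * k))) := by
    refine integral_mono iT (((i1.const_mul _).add (i2.const_mul _)).add (i3.const_mul _))
      fun x => ?_
    by_cases hx : x ∈ ann N R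
    · obtain ⟨b1, b2, -⟩ := hb R hR x
      have hx0 : x ≠ 0 := ann_subset hR hx
      have hu := h.u0 x
      have hv := h.v0 x
      have hω := bump_nonneg hR x
      have hvv := gdot_self_nonneg v x
      have hus : u x / src b q u x ≤ A * B * u x ^ (1 - q) := by
        rw [div_le_iff₀ (src_pos h.u0 hx0), src, Real.rpow_sub hu, Real.rpow_one]
        have huq := Real.rpow_pos_of_pos hu q
        have := (norm_rpow_le hR hx b).2
        calc u x = B * R ^ b * u x := by rw [hBb, one_mul]
          _ ≤ B * (A * ‖x‖ ^ b) * u x := by gcongr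
          _ = _ := by field_simp
      have hus0 : 0 ≤ u x / src b q u x := div_nonneg hu.le (src_pos h.u0 hx0).le
      have hω2 := pow_le_pow_of_le_one hω (bump_le_one R x) (show 2 * k ≤ 2 * k + 2 by omega)
      have hl : lap (fun y => cut R y ^ (k + 2)) x ^ 2 ≤ (C1 / R ^ 2 * bump R x ^ k) ^ 2 :=
        sq_le_sq' (by linarith [(abs_le.1 b2).1]) (abs_le.1 b2).2
      have hur := Real.rpow_pos_of_pos hu (1 - q)
      have hgn := gdot_self_nonneg (fun y => cut R y ^ (k + 2)) x
      calc stabDens u v (src b q u) (fun y => cut R y ^ (k + 2)) x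
          ≤ u x * v x * (C1 / R ^ 2 * bump R x ^ (2 * k + 2)) + A * B * u x ^ (1 - q) *
            (8 * gdot v v x * (C1 / R ^ 2 * bump R x ^ (2 * k + 2)) +
              2 * v x ^ 2 * (C1 / R ^ 2 * bump R x ^ k) ^ 2) := by
            rw [stabDens]; gcongr
        _ ≤ u x * v x * (C1 / R ^ 2 * bump R x ^ (2 * k)) + A * B * u x ^ (1 - q) *
            (8 * gdot v v x * (C1 / R ^ 2 * bump R x ^ (2 * k + 2)) +
              2 * v x ^ 2 * (C1 / R ^ 2 * bump R x ^ k) ^ 2) := by gcongr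
        _ = _ := by rw [mul_comm 2 k, pow_mul]; ring
    · simp [stabDens, hgl x hx, bump_eq_zero hR hx, hk]
  have s1 := integral_add ((i1.const_mul (C1 / R ^ 2)).add (i2.const_mul (8 * A * C1 * B / R ^ 2)))
    (i3.const_mul (2 * A * C1 ^ 2 * B / R ^ 4))
  have s2 := integral_add (i1.const_mul (C1 / R ^ 2)) (i2.const_mul (8 * A * C1 * B / R ^ 2))
  simp only [Pi.add_apply] at s1
  rw [s1, s2, integral_const_mul, integral_const_mul, integral_const_mul] at ineq
  have t1 : ∫ x, R ^ (-2 : ℝ) * v x ^ (1 : ℝ) * u x ^ (1 : ℝ) * bump R x ^ (2 * k) =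
      1 / R ^ 2 * ∫ x, u x * v x * bump R x ^ (2 * k) := by
    rw [← integral_const_mul]
    exact integral_congr_ae (Filter.Eventually.of_forall fun x => by
      simp only [hR2, Real.rpow_one]; ring)
  have t3 : ∫ x, R ^ (-b - 4) * v x ^ (2 : ℝ) * u x ^ (1 - q) * bump R x ^ (2 * k) =
      B / R ^ 4 * ∫ x, u x ^ (1 - q) * v x ^ 2 * bump R x ^ (2 * k) := by
    rw [← integral_const_mul]
    exact integral_congr_ae (Filter.Eventually.of_forall fun x => by
      simp only [hR4, Real.rpow_two]; ring)
  rw [t1, t3]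
  have p1 : 0 ≤ ∫ x, u x * v x * bump R x ^ (2 * k) := integral_nonneg fun x =>
    mul_nonneg (mul_nonneg (h.u0 x).le (h.v0 x).le) (pow_nonneg (bump_nonneg hR x) _)
  have p3 : 0 ≤ ∫ x, u x ^ (1 - q) * v x ^ 2 * bump R x ^ (2 * k) := integral_nonneg fun x =>
    mul_nonneg (mul_nonneg (Real.rpow_nonneg (h.u0 x).le _) (sq_nonneg _))
      (pow_nonneg (bump_nonneg hR x) _)
  generalize ∫ x, u x * v x * bump R x ^ (2 * k) = I1 at *
  generalize ∫ x, u x ^ (1 - q) * gdot v v x * bump R x ^ (2 * k + 2) = I2 at *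
  generalize ∫ x, u x ^ (1 - q) * v x ^ 2 * bump R x ^ (2 * k) = I3 at *
  calc _ ≤ _ := ineq
    _ ≤ C1 / R ^ 2 * I1 + 8 * A * C1 * B / R ^ 2 * (C2 * (R ^ b * I1 + 1 / R ^ 2 * I3)) +
        2 * A * C1 ^ 2 * B / R ^ 4 * I3 := by gcongr
    _ = (C1 + 8 * A * C1 * C2 * (B * R ^ b)) * (1 / R ^ 2 * I1) +
        (8 * A * C1 * C2 + 2 * A * C1 ^ 2) * (B / R ^ 4 * I3) := by ring
    _ ≤ (C1 + 8 * A * C1 * C2 + 2 * A * C1 ^ 2) * (1 / R ^ 2 * I1) +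
        (C1 + 8 * A * C1 * C2 + 2 * A * C1 ^ 2) * (B / R ^ 4 * I3) := by
      rw [hBb]
      gcongr ?_ * _ + ?_ * _
      · nlinarith [mul_pos hA0 (pow_pos hC1 2)]
      · linarith
    _ = _ := by ring

end PosSol

namespace PosSol

variable {p q a b : ℝ} {u v : Euc N → ℝ}

lemma integrable_dens_bump (h : PosSol p q a b u v) {R : ℝ} (hR : 0 < R) {m : ℕ} (hm : m ≠ 0) :
    Integrable fun x => dens p q a b u v x * bump R x ^ m :=
  integrable_mul_bump hR h.continuousOn_dens hm

lemma integral_monomial_eps (h : PosSol p q a b u v) {e α β γ r s t ε : ℝ} {n m : ℕ}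
    (hα : 0 ≤ α) (hβ : 0 ≤ β) (hγ : 0 < γ) (h1 : α + β + γ = 1)
    (hr : r = a * α + b * β + e * γ) (hs : s = (p + 1) * α) (ht : t = (q + 1) * β)
    (hε : 0 < ε) (hn : n ≠ 0) (hm0 : m ≠ 0) (hm : m * (1 - γ) + γ ≤ n) {R : ℝ} (hR : 0 < R) :
    ∫ x, R ^ r * v x ^ s * u x ^ t * bump R x ^ n ≤
      ε * 2 ^ (|a| + |b|) * (∫ x, dens p q a b u v x * bump R x ^ m) +
        ε ^ (-(1 - γ) / γ) * (∫ x : Euc N, bump 1 x) * R ^ (e + N) := by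
  have ib : Integrable fun x : Euc N => bump R x := by
    simpa using integrable_mul_bump (N := N) (F := fun _ => 1) hR continuousOn_const one_ne_zero
  have id := h.integrable_dens_bump hR hm0
  have im : Integrable fun x => R ^ r * v x ^ s * u x ^ t * bump R x ^ n :=
    integrable_mul_bump hR ((continuous_const.mul (continuous_rpow h.cv h.v0 s)).mul
      (continuous_rpow h.cu h.u0 t)).continuousOn hn
  have key : ∫ x, R ^ r * v x ^ s * u x ^ t * bump R x ^ n ≤
      ∫ x, (ε * 2 ^ (|a| + |b|) * (dens p q a b u v x * bump R x ^ m) +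
        ε ^ (-(1 - γ) / γ) * R ^ e * bump R x) := by
    refine integral_mono im ((id.const_mul _).add (ib.const_mul _)) fun x => ?_
    by_cases hx : x ∈ ann N R
    · have hω := bump_nonneg hR x
      refine (young_monomial_eps hR (h.u0 x) (h.v0 x) hα hβ hγ h1 hr hs ht hε hω
        (bump_le_one R x) hn hm).trans ?_
      have hd := h.monomials_le_dens hR hx
      calc _ ≤ ε * (2 ^ (|a| + |b|) * dens p q a b u v x) * bump R x ^ m +
            ε ^ (-(1 - γ) / γ) * (R ^ e * bump R x) := by gcongr
        _ = _ := by ring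
    · simp [bump_eq_zero hR hx, hn, hm0]
  rw [integral_add (id.const_mul _) (ib.const_mul _), integral_const_mul, integral_const_mul,
    integral_bump hR] at key
  rw [Real.rpow_add hR, Real.rpow_natCast]
  linarith

lemma integral_stabDens_eps (h : PosSol p q a b u v) (hp : 1 < p) (hq0 : 0 < q) (hq1 : q < 1)
    {θ e : ℝ}
    (hθ : θ = 1 - 1 / (p + 1) - 1 / (q + 1)) (hθ0 : 0 < θ)
    (he : e * θ = -2 - a / (p + 1) - b / (q + 1)) {k : ℕ} (hk : 5 ≤ (2 * k + 4) * θ) {ε : ℝ}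
    (hε : 0 < ε) : ∃ C, 0 ≤ C ∧ ∀ R : ℝ, 0 < R →
    Integrable (stabDens u v (src b q u) fun y => cut R y ^ (k + 2)) ∧
    ∫ x, stabDens u v (src b q u) (fun y => cut R y ^ (k + 2)) x ≤
      ε * (∫ x, dens p q a b u v x * bump R x ^ (2 * k + 4)) + C * R ^ (e + N) := by
  have hp1 : 0 < 1 / (p + 1) := by positivity
  have hq2 : 1 / 2 < 1 / (q + 1) := one_div_lt_one_div_of_lt (by linarith) (by linarith)
  have hk0 : k ≠ 0 := by
    rintro rfl
    norm_num at hk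
    linarith
  obtain ⟨C, hC, hb⟩ := h.integral_stabDens_bound hq0 hq1 hk0
  set A : ℝ := 2 ^ (|a| + |b|) with hA
  have hA0 : 0 < A := by positivity
  set J := ∫ x : Euc N, bump 1 x with hJ
  have hJ0 : 0 ≤ J := integral_nonneg fun x => bump_nonneg one_pos x
  set ε' := ε / (2 * C * A) with hε'
  have hε0 : 0 < ε' := by positivity
  refine ⟨C * (ε' ^ (-(1 - θ) / θ) * J + ε' ^ (-(1 - 2 * θ) / (2 * θ)) * J), by positivity,
    fun R hR => ⟨(hb R hR).1, (hb R hR).2.trans ?_⟩⟩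
  have hp0 : p + 1 ≠ 0 := by positivity
  have hq0' : q + 1 ≠ 0 := by positivity
  have hm : ((2 * k + 4 : ℕ) : ℝ) * (1 - θ) + θ ≤ ((2 * k : ℕ) : ℝ) := by
    push_cast; nlinarith
  have hm' : ((2 * k + 4 : ℕ) : ℝ) * (1 - 2 * θ) + 2 * θ ≤ ((2 * k : ℕ) : ℝ) := by
    push_cast; nlinarith
  have y1 := h.integral_monomial_eps (e := e) (α := 1 / (p + 1)) (β := 1 / (q + 1)) (γ := θ)
    (r := -2) (s := 1) (t := 1) (n := 2 * k) (m := 2 * k + 4) hp1.le (by linarith) hθ0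
    (by linarith) (by rw [he]; ring) (by field_simp) (by field_simp) hε0 (by simp [hk0])
    (by simp) hm hR
  have y2 := h.integral_monomial_eps (e := e) (α := 2 * (1 / (p + 1))) (β := 2 * (1 / (q + 1)) - 1)
    (γ := 2 * θ) (r := -b - 4) (s := 2) (t := 1 - q) (n := 2 * k) (m := 2 * k + 4) (by linarith)
    (by linarith) (by linarith) (by linarith) (by linear_combination (-2) * he)
    (by field_simp) (by field_simp; ring) hε0 (by simp [hk0]) (by simp) hm' hR
  generalize ∫ x, R ^ (-2 : ℝ) * v x ^ (1 : ℝ) * u x ^ (1 : ℝ) * bump R x ^ (2 * k) = I1 at *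
  generalize ∫ x, R ^ (-b - 4) * v x ^ (2 : ℝ) * u x ^ (1 - q) * bump R x ^ (2 * k) = I3 at *
  refine (mul_le_mul_of_nonneg_left (add_le_add y1 y2) hC.le).trans_eq ?_
  have : C * ε' * A = ε / 2 := by rw [hε']; field_simp
  linear_combination (2 * ∫ x, dens p q a b u v x * bump R x ^ (2 * k + 4)) * this

end PosSol

lemma two_pow_mul_div_two (ρ : ℝ) (j : ℕ) : 2 ^ (j + 1) * ρ / 2 = 2 ^ j * ρ := by
  rw [pow_succ]; ring

lemma sum_bump (ρ : ℝ) (n : ℕ) (x : Euc N) :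
    ∑ j ∈ Finset.range n, bump (2 ^ (j + 1) * ρ) x = cut (2 ^ n * ρ) x - cut ρ x := by
  simp only [bump, two_pow_mul_div_two]
  rw [Finset.sum_range_sub (fun j => cut (2 ^ j * ρ) x)]
  simp

lemma continuous_cut (R : ℝ) : Continuous (cut R : Euc N → ℝ) :=
  (cut_contDiff R (n := 0)).continuous

lemma stabDens_nonneg {u v g : Euc N → ℝ} {x : Euc N} (hu : 0 ≤ u x) (hv : 0 ≤ v x)
    (hg : 0 ≤ g x) (η : Euc N → ℝ) : 0 ≤ stabDens u v g η x := by
  have h1 := gdot_self_nonneg η x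
  have h2 := gdot_self_nonneg v x
  rw [stabDens]
  positivity

namespace PosSol

variable {p q a b : ℝ} {u v : Euc N → ℝ}

lemma integral_dens_le_stabDens (h : PosSol p q a b u v) (hq0 : 0 < q) (hpq : 1 < p * q)
    {K : Set (Euc N)} (hK : HLEStableOutside p q a b u v K) {r r' R R' : ℝ} (hr : 0 < r)
    (hKr : K ⊆ ball 0 r) (hr' : r < r') (hR : R < R') {η : Euc N → ℝ} (hη : ContDiff ℝ 2 η)
    (h0 : ∀ x ∉ {x : Euc N | r' ≤ ‖x‖ ∧ ‖x‖ ≤ R}, η x = 0) :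
    ∫ x, dens p q a b u v x * η x ^ 2 ≤
      (6 / (p * q - 1) + 4) * ∫ x, stabDens u v (src b q u) η x := by
  set Ω : Set (Euc N) := {x | r < ‖x‖ ∧ ‖x‖ < R'} with hΩ
  have hcl : closure Ω ⊆ {x : Euc N | r ≤ ‖x‖ ∧ ‖x‖ ≤ R'} :=
    closure_minimal (fun x hx => ⟨hx.1.le, hx.2.le⟩) (isCompact_annulus r R').isClosed
  have hΩo : IsOpen Ω :=
    (isOpen_lt continuous_const continuous_norm).inter (isOpen_lt continuous_norm continuous_const)
  have hΩ0 : Ω ⊆ {x | x ≠ 0} := fun x hx hx0 => by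
    have := hx.1
    rw [hx0, norm_zero] at this
    linarith
  obtain ⟨ξ, ζ, hξ, hζ, hξ0, hζ0, h1, h2⟩ := hK.2 Ω hΩo
    ((isCompact_annulus r R').of_isClosed_subset isClosed_closure hcl) fun x hx hxK => by
      have := (hcl hx).1
      have := mem_ball_zero_iff.1 (hKr hxK)
      linarith
  exact integral_energy_le hq0 hpq hΩo (isCompact_annulus r' R)
    (fun x hx => ⟨hr'.trans_le hx.1, hx.2.trans_lt hR⟩) hξ hζ hξ0 hζ0 (h.hu.mono hΩ0)
    (h.hv.mono hΩ0) (fun x _ => h.u0 x) (fun x _ => h.v0 x)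
    ((continuousOn_src h.cv h.v0 a p).mono hΩ0) ((continuousOn_src h.cu h.u0 b q).mono hΩ0)
    (fun x hx => src_pos h.u0 (hΩ0 hx)) (fun x hx => h.eu x (hΩ0 hx))
    (fun x hx => h.ev x (hΩ0 hx))
    (fun x hx => by
      have e := h1 x hx
      rwa [Real.rpow_sub_one (h.v0 x).ne', mul_assoc p, ← mul_div_assoc] at e)
    (fun x hx => by
      have e := h2 x hx
      rwa [Real.rpow_sub_one (h.u0 x).ne', mul_assoc q, ← mul_div_assoc] at e)
    hη.contDiffOn h0

lemma integral_dens_bounded (h : PosSol p q a b u v) (hp : 1 < p) (hq0 : 0 < q) (hq1 : q < 1)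
    (hpq : 1 < p * q) {K : Set (Euc N)} (hK : HLEStableOutside p q a b u v K) {θ e : ℝ}
    (hθ : θ = 1 - 1 / (p + 1) - 1 / (q + 1)) (hθ0 : 0 < θ)
    (he : e * θ = -2 - a / (p + 1) - b / (q + 1)) (heN : e + N ≤ 0) :
    ∃ k : ℕ, ∃ r M : ℝ, 0 < r ∧ ∀ R : ℝ, 4 * r ≤ R →
      ∫ x, dens p q a b u v x * (cut R x ^ (k + 2) - cut r x ^ (k + 2)) ^ 2 ≤ M := by
  obtain ⟨k, hk⟩ := exists_nat_ge (5 / θ)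
  have hk5 : 5 ≤ (2 * k + 4) * θ := by
    rw [div_le_iff₀ hθ0] at hk
    have : 0 ≤ (k : ℝ) * θ := by positivity
    nlinarith
  obtain ⟨r0, hr0⟩ := hK.1.isBounded.subset_ball (0 : Euc N)
  set r := max r0 1 with hr
  have hr1 : 1 ≤ r := le_max_right _ _
  have hKr : K ⊆ ball 0 r := hr0.trans (ball_subset_ball (le_max_left _ _))
  set C0 := 6 / (p * q - 1) + 4 with hC0
  have hC0p : 0 < C0 := by
    have : 0 < p * q - 1 := by linarith
    positivity
  obtain ⟨C, hC, hT⟩ := h.integral_stabDens_eps hp hq0 hq1 hθ hθ0 he hk5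
    (ε := 1 / (4 * C0)) (by positivity)
  set T : ℝ → Euc N → ℝ := fun R => stabDens u v (src b q u) fun y => cut R y ^ (k + 2) with hTdef
  refine ⟨k, 2 * r, 4 * C0 * C + 4 * C0 * ∫ x, T (2 * r) x, by linarith, fun R hR => ?_⟩
  have hR0 : 0 < R := by linarith
  have h2r : 0 < 2 * r := by linarith
  set η : Euc N → ℝ := fun x => cut R x ^ (k + 2) - cut (2 * r) x ^ (k + 2) with hη
  have cR : ContDiff ℝ 2 fun y : Euc N => cut R y ^ (k + 2) := (cut_contDiff R (n := 2)).pow _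
  have cr : ContDiff ℝ 2 fun y : Euc N => cut (2 * r) y ^ (k + 2) :=
    (cut_contDiff (2 * r) (n := 2)).pow _
  have hη0 : ∀ x ∉ {x : Euc N | 2 * r ≤ ‖x‖ ∧ ‖x‖ ≤ 2 * R}, η x = 0 := by
    intro x hx
    simp only [mem_ofPred_eq, not_and_or, not_le] at hx
    simp only [hη]
    rcases hx with hx | hx
    · rw [cut_eq_one hR0 (by linarith), cut_eq_one h2r hx.le, sub_self]
    · rw [cut_eq_zero hR0 hx.le, cut_eq_zero h2r (by linarith), sub_self]
  have hS0 : {x : Euc N | 2 * r ≤ ‖x‖ ∧ ‖x‖ ≤ 2 * R} ⊆ {x | x ≠ 0} := fun x hx hx0 => by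
    have := hx.1
    rw [hx0, norm_zero] at this
    linarith
  have E := h.integral_dens_le_stabDens hq0 hpq hK (by linarith) hKr (r' := 2 * r)
    (R := 2 * R) (R' := 3 * R) (by linarith) (by linarith) (cR.sub cr) hη0
  have iR := (hT R hR0).1
  have ir := (hT (2 * r) h2r).1
  have hTn : ∀ ρ x, 0 ≤ T ρ x := fun ρ x =>
    stabDens_nonneg (h.u0 x).le (h.v0 x).le (src_nonneg h.u0 x) _
  have E2 : ∫ x, stabDens u v (src b q u) η x ≤ ∫ x, (2 * T R x + 2 * T (2 * r) x) := by
    refine integral_mono_of_nonneg (Filter.Eventually.of_forall fun x =>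
      stabDens_nonneg (h.u0 x).le (h.v0 x).le (src_nonneg h.u0 x) _)
      ((iR.const_mul 2).add (ir.const_mul 2)) (Filter.Eventually.of_forall fun x => ?_)
    by_cases hx : x ∈ {x : Euc N | 2 * r ≤ ‖x‖ ∧ ‖x‖ ≤ 2 * R}
    · exact stabDens_sub_le (h.u0 x) (h.v0 x) (src_pos h.u0 (hS0 hx)) cR.contDiffAt cr.contDiffAt
    · have hc := isCompact_annulus (N := N) (2 * r) (2 * R)
      have := hTn R x
      have := hTn (2 * r) x
      simp only [stabDens, gdot_eq_zero η hc hη0 hx, lap_eq_zero hc hη0 hx]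
      simp only [mul_zero, ne_eq, OfNat.ofNat_ne_zero, not_false_eq_true, zero_pow, add_zero]
      positivity
  rw [integral_add (iR.const_mul 2) (ir.const_mul 2), integral_const_mul, integral_const_mul] at E2
  have iη : Integrable fun x => dens p q a b u v x * η x ^ 2 :=
    integrable_of_continuousOn (isCompact_annulus (2 * r) (2 * R))
      ((h.continuousOn_dens.mono hS0).mul ((cR.sub cr).continuous.pow 2).continuousOn)
      fun x hx => by simp [hη0 x hx]
  have E3 : ∫ x, dens p q a b u v x * bump R x ^ (2 * k + 4) ≤
      ∫ x, dens p q a b u v x * η x ^ 2 := by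
    refine integral_mono (h.integrable_dens_bump hR0 (by simp)) iη fun x => ?_
    have hd := h.dens_nonneg x
    refine mul_le_mul_of_nonneg_left ?_ hd
    by_cases hx : x ∈ ann N R
    · have : η x = cut R x ^ (k + 2) := by
        simp only [hη]
        rw [cut_eq_zero h2r (by linarith [hx.1]), zero_pow (by simp), sub_zero]
      rw [this, ← pow_mul, show (k + 2) * 2 = 2 * k + 4 by ring]
      exact pow_le_pow_left₀ (bump_nonneg hR0 x) (bump_le_cut R x) _
    · rw [bump_eq_zero hR0 hx, zero_pow (by simp)]
      positivity
  have E4 : R ^ (e + N) ≤ 1 := Real.rpow_le_one_of_one_le_of_nonpos (by linarith) heN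
  have E5 := (hT R hR0).2
  have E6 : ∫ x, T R x ≤ 1 / (4 * C0) * (∫ x, dens p q a b u v x * η x ^ 2) + C := by
    refine E5.trans (add_le_add (by gcongr) ?_)
    nlinarith
  have E7 : C0 * ∫ x, stabDens u v (src b q u) η x ≤
      C0 * (2 * (1 / (4 * C0) * (∫ x, dens p q a b u v x * η x ^ 2) + C) +
        2 * ∫ x, T (2 * r) x) := by
    refine mul_le_mul_of_nonneg_left (E2.trans ?_) hC0p.le
    linarith
  have E8 : C0 * (2 * (1 / (4 * C0) * (∫ x, dens p q a b u v x * η x ^ 2) + C) +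
      2 * ∫ x, T (2 * r) x) = (∫ x, dens p q a b u v x * η x ^ 2) / 2 + 2 * C0 * C +
        2 * C0 * ∫ x, T (2 * r) x := by
    field_simp
    ring
  linarith

lemma tendsto_integral_dens_bump (h : PosSol p q a b u v) {k : ℕ} {r M : ℝ} (hr : 0 < r)
    (hM : ∀ R : ℝ, 4 * r ≤ R →
      ∫ x, dens p q a b u v x * (cut R x ^ (k + 2) - cut r x ^ (k + 2)) ^ 2 ≤ M) :
    Filter.Tendsto (fun j : ℕ => ∫ x, dens p q a b u v x * bump (2 ^ (j + 1) * (2 * r)) x)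
      Filter.atTop (nhds 0) := by
  set ρ := 2 * r with hρ
  have hρ0 : 0 < ρ := by linarith
  have hb : ∀ j : ℕ, Integrable fun x => dens p q a b u v x * bump (2 ^ (j + 1) * ρ) x := by
    intro j
    simpa using h.integrable_dens_bump (R := 2 ^ (j + 1) * ρ) (by positivity) one_ne_zero
  refine (summable_of_sum_range_le (c := M) (fun j => integral_nonneg fun x =>
    mul_nonneg (h.dens_nonneg x) (bump_nonneg (by positivity) x)) fun n => ?_).tendsto_atTop_zero
  rw [← integral_finsetSum _ fun j _ => hb j]
  have hn1 : (1 : ℝ) ≤ 2 ^ n := one_le_pow₀ (by norm_num)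
  have hn : 4 * r ≤ 2 ^ n * ρ * 2 := by nlinarith
  refine le_trans ?_ (hM (2 ^ n * ρ * 2) hn)
  have hR0 : 0 < 2 ^ n * ρ * 2 := by positivity
  have hS0 : {x : Euc N | r ≤ ‖x‖ ∧ ‖x‖ ≤ 2 * (2 ^ n * ρ * 2)} ⊆ {x | x ≠ 0} := fun x hx hx0 => by
    have := hx.1
    rw [hx0, norm_zero] at this
    linarith
  refine integral_mono (integrable_finsetSum _ fun j _ => hb j)
    (integrable_of_continuousOn (isCompact_annulus r (2 * (2 ^ n * ρ * 2)))
      ((h.continuousOn_dens.mono hS0).mul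
        ((((continuous_cut _).pow _).sub ((continuous_cut _).pow _)).pow 2).continuousOn)
      fun x hx => ?_) fun x => ?_
  · simp only [mem_ofPred_eq, not_and_or, not_le] at hx
    rcases hx with hx | hx
    · rw [cut_eq_one hR0 (by linarith), cut_eq_one hr hx.le]; simp
    · rw [cut_eq_zero hR0 hx.le, cut_eq_zero hr (by linarith)]; simp
  · simp only [← Finset.mul_sum, sum_bump]
    refine mul_le_mul_of_nonneg_left ?_ (h.dens_nonneg x)
    rcases le_total ‖x‖ ρ with hx | hx
    · rw [cut_eq_one hρ0 hx, cut_eq_one (by positivity) (by nlinarith), sub_self]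
      positivity
    · rcases le_total (2 ^ n * ρ * 2) ‖x‖ with hx' | hx'
      · rw [cut_eq_zero (R := 2 ^ n * ρ) (by positivity) (by linarith)]
        nlinarith [cut_nonneg ρ x, sq_nonneg (cut (2 ^ n * ρ * 2) x ^ (k + 2) - cut r x ^ (k + 2))]
      · rw [cut_eq_one hR0 hx', cut_eq_zero hr (by linarith)]
        have := cut_le_one (2 ^ n * ρ) x
        have := cut_nonneg ρ x
        simp
        linarith

end PosSol

/-! ### Boundary terms in the Pohozaev identity -/

lemma abs_xd_le (f : Euc N → ℝ) (x : Euc N) : |xd f x| ≤ ‖x‖ * √(gdot f f x) := by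
  have h := Finset.sum_mul_sq_le_sq_mul_sq Finset.univ (fun i => x i) (fun i => pd i f x)
  have e : ‖x‖ ^ 2 * gdot f f x = (∑ i, x i ^ 2) * ∑ i, pd i f x ^ 2 := by
    rw [EuclideanSpace.real_norm_sq_eq]
    simp only [gdot, sq]
  rw [← e] at h
  rw [← Real.sqrt_sq (norm_nonneg x), ← Real.sqrt_mul (sq_nonneg _)]
  exact Real.abs_le_sqrt h

lemma abs_gdot_le (f g : Euc N → ℝ) (x : Euc N) :
    |gdot f g x| ≤ √(gdot f f x) * √(gdot g g x) := by
  rw [← Real.sqrt_mul (gdot_self_nonneg f x)]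
  exact Real.abs_le_sqrt (gdot_sq_le f g x)

lemma sum_pd_mul_pohozaevField (η u v Φ : Euc N → ℝ) (c d : ℝ) (x : Euc N) :
    ∑ i, pd i η x * pohozaevField u v Φ c d i x =
      gdot η u x * xd v x + gdot η v x * xd u x + xd η x * (Φ x - gdot u v x) +
        (c * (v x * gdot η u x) + d * (u x * gdot η v x)) := by
  have e1 : gdot η u x = ∑ i, pd i η x * pd i u x := rfl
  have e2 : gdot η v x = ∑ i, pd i η x * pd i v x := rfl
  have e3 : xd η x = ∑ i, x i * pd i η x := rfl
  rw [e1, e2, e3]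
  simp only [Finset.sum_mul, Finset.mul_sum, ← Finset.sum_add_distrib]
  exact Finset.sum_congr rfl fun i _ => by rw [pohozaevField]; ring

lemma abs_sum_pd_mul_pohozaevField_le {η u v Φ : Euc N → ℝ} {c d R C w ω : ℝ} {x : Euc N}
    (hR : 0 < R) (hw : 0 < w) (hC : 0 ≤ C) (hω : 0 ≤ ω)
    (hη : gdot η η x ≤ (C / R * ω) ^ 2) (hx : ‖x‖ ≤ 2 * R) (hu : 0 < u x) (hv : 0 < v x)
    (hΦ : 0 ≤ Φ x) :
    |∑ i, pd i η x * pohozaevField u v Φ c d i x| ≤ C * (6 + |c| + |d|) * (ω *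
      (w * gdot v v x + w⁻¹ * gdot u u x + Φ x +
        1 / R ^ 2 * (w * v x ^ 2 + w⁻¹ * u x ^ 2))) := by
  set m := √(gdot η η x) with hm
  set y := √(gdot u u x) with hy
  set z := √(gdot v v x) with hz
  have hy2 : gdot u u x = y ^ 2 := (Real.sq_sqrt (gdot_self_nonneg u x)).symm
  have hz2 : gdot v v x = z ^ 2 := (Real.sq_sqrt (gdot_self_nonneg v x)).symm
  have hm0 : 0 ≤ m := Real.sqrt_nonneg _
  have hy0 : 0 ≤ y := Real.sqrt_nonneg _
  have hz0 : 0 ≤ z := Real.sqrt_nonneg _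
  have hmC : m ≤ C / R * ω := Real.sqrt_le_iff.2 ⟨by positivity, hη⟩
  have a1 : |gdot η u x| ≤ m * y := abs_gdot_le η u x
  have a2 : |gdot η v x| ≤ m * z := abs_gdot_le η v x
  have a3 : |gdot u v x| ≤ y * z := abs_gdot_le u v x
  have b1 : |xd u x| ≤ 2 * R * y := (abs_xd_le u x).trans (by gcongr)
  have b2 : |xd v x| ≤ 2 * R * z := (abs_xd_le v x).trans (by gcongr)
  have b3 : |xd η x| ≤ 2 * R * m := (abs_xd_le η x).trans (by gcongr)
  rw [hy2, hz2, sum_pd_mul_pohozaevField]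
  have step : |gdot η u x * xd v x + gdot η v x * xd u x + xd η x * (Φ x - gdot u v x) +
        (c * (v x * gdot η u x) + d * (u x * gdot η v x))| ≤
      m * y * (2 * R * z) + m * z * (2 * R * y) + 2 * R * m * (Φ x + y * z) +
        (|c| * (v x * (m * y)) + |d| * (u x * (m * z))) := by
    refine (abs_add_le _ _).trans (add_le_add ((abs_add_le _ _).trans (add_le_add
      ((abs_add_le _ _).trans (add_le_add ?_ ?_)) ?_)) ((abs_add_le _ _).trans (add_le_add ?_ ?_)))
    · rw [abs_mul]; gcongr
    · rw [abs_mul]; gcongr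
    · rw [abs_mul]
      have : |Φ x - gdot u v x| ≤ Φ x + y * z := by
        refine (abs_sub _ _).trans ?_
        rw [abs_of_nonneg hΦ]
        gcongr
      gcongr
    · rw [abs_mul, abs_mul, abs_of_pos hv]; gcongr
    · rw [abs_mul, abs_mul, abs_of_pos hu]; gcongr
  refine step.trans ?_
  clear_value m y z
  have hwi : 0 < w⁻¹ := inv_pos.2 hw
  have amgm : ∀ s t : ℝ, 2 * (s * t) ≤ w * s ^ 2 + w⁻¹ * t ^ 2 := by
    intro s t
    have e : w * s ^ 2 + w⁻¹ * t ^ 2 - 2 * (s * t) = w⁻¹ * (w * s - t) ^ 2 := by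
      field_simp
      ring
    have : 0 ≤ w⁻¹ * (w * s - t) ^ 2 := by positivity
    linarith
  have c1 := amgm z y
  have c2 := amgm (1 / R * v x) y
  have c3 := amgm z (1 / R * u x)
  set P := w * z ^ 2 + w⁻¹ * y ^ 2 + Φ x + 1 / R ^ 2 * (w * v x ^ 2 + w⁻¹ * u x ^ 2) with hP
  have e0 : 1 / R ^ 2 * (w * v x ^ 2 + w⁻¹ * u x ^ 2) =
    w * (1 / R * v x) ^ 2 + w⁻¹ * (1 / R * u x) ^ 2 := by ring
  have n1 : 0 ≤ w * z ^ 2 := by positivity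
  have n2 : 0 ≤ w⁻¹ * y ^ 2 := by positivity
  have n3 : 0 ≤ w * (1 / R * v x) ^ 2 := by positivity
  have n4 : 0 ≤ w⁻¹ * (1 / R * u x) ^ 2 := by positivity
  have d1 : 6 * (y * z) + 2 * Φ x ≤ 6 * P := by rw [hP, e0]; linarith
  have d2 : 1 / R * v x * y ≤ P := by rw [hP, e0]; linarith
  have d3 : z * (1 / R * u x) ≤ P := by rw [hP, e0]; linarith
  calc _ = (m * R) * (6 * (y * z) + 2 * Φ x + |c| * (1 / R * v x * y) +
        |d| * (z * (1 / R * u x))) := by field_simp; ring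
    _ ≤ (C / R * ω * R) * (6 * P + |c| * P + |d| * P) := by gcongr
    _ = _ := by field_simp

/-- The localized integral of a monomial in two functions. -/
def wInt (v u : Euc N → ℝ) (s t R : ℝ) : ℝ := ∫ x, v x ^ s * u x ^ t * bump R x

lemma wInt_comm (v u : Euc N → ℝ) (s t R : ℝ) : wInt v u s t R = wInt u v t s R :=
  integral_congr_ae (Filter.Eventually.of_forall fun x => by ring)

lemma wInt_nonneg {v u : Euc N → ℝ} (hv : ∀ x, 0 < v x) (hu : ∀ x, 0 < u x) (s t : ℝ) {R : ℝ}
    (hR : 0 < R) : 0 ≤ wInt v u s t R :=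
  integral_nonneg fun x => mul_nonneg (mul_nonneg (Real.rpow_nonneg (hv x).le s)
    (Real.rpow_nonneg (hu x).le t)) (bump_nonneg hR x)

namespace PosSol

variable {p q a b : ℝ} {u v : Euc N → ℝ}

lemma integrable_wInt (h : PosSol p q a b u v) (s t : ℝ) {R : ℝ} (hR : 0 < R) {j : ℕ}
    (hj : j ≠ 0) : Integrable fun x => v x ^ s * u x ^ t * bump R x ^ j :=
  integrable_mul_bump hR
    ((continuous_rpow h.cv h.v0 s).mul (continuous_rpow h.cu h.u0 t)).continuousOn hj

lemma weighted_gradient_bound (h : PosSol p q a b u v) {t s : ℝ} (ht : 0 < t) (hs0 : 0 ≤ s)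
    (hs1 : s < 1) : ∃ C, 0 < C ∧ ∀ R : ℝ, 0 < R →
    ∫ x, v x ^ (t - 1) * u x ^ s * gdot v v x * bump R x ^ 3 ≤
      C * (R ^ b * wInt v u t (q + s) R + 1 / R ^ 2 * wInt v u (t + 1) s R) := by
  obtain ⟨C, hC, hb⟩ := exists_bound_pow N 1
  have hs2 : 0 < 1 - s := by linarith
  set C' := 1 / ((t + 1) * (1 - s)) * C with hC'
  have hC'0 : 0 < C' := by positivity
  refine ⟨1 / t * (2 ^ |b| + C'), by positivity, fun R hR => ?_⟩
  have hU := isOpen_punctured (N := N)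
  have hbc : ContDiff ℝ 2 (bump R : Euc N → ℝ) := bump_contDiff R (n := 2)
  have key := integral_gradient_le (f := v) (g := u) (χ := fun x => bump R x ^ 3)
    (D := fun x => C / R ^ 2 * bump R x) ht hs0 hs1 hU (isCompact_ann R) (ann_subset hR) h.hv h.hu
    (fun x _ => h.v0 x) (fun x _ => h.u0 x) (fun x hx => h.lap_nonpos hx) (hbc.pow _).contDiffOn
    (fun x => pow_nonneg (bump_nonneg hR x) _) (fun x hx => by simp [bump_eq_zero hR hx])
    (continuous_const.mul hbc.continuous).continuousOn
    (fun x hx => by simp [bump_eq_zero hR hx])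
    (fun x _ => by simpa using (hb R hR x).2.2.1)
    (fun x _ => by simpa using (hb R hR x).2.2.2)
  have e1 : ∫ x, -lap v x * v x ^ t * u x ^ s * bump R x ^ 3 ≤
      ∫ x, 2 ^ |b| * R ^ b * (v x ^ t * u x ^ (q + s) * bump R x ^ 1) := by
    refine integral_mono (integrable_mul_bump hR (((continuousOn_lap hU h.hv).neg.mul
      (continuous_rpow h.cv h.v0 t).continuousOn).mul (continuous_rpow h.cu h.u0 s).continuousOn)
      (by simp)) ((h.integrable_wInt t (q + s) hR one_ne_zero).const_mul _) fun x => ?_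
    by_cases hx : x ∈ ann N R
    · have hx0 : x ≠ 0 := ann_subset hR hx
      have hvt := Real.rpow_pos_of_pos (h.v0 x) t
      have huq := Real.rpow_pos_of_pos (h.u0 x) q
      have hus := Real.rpow_pos_of_pos (h.u0 x) s
      have hω := bump_nonneg hR x
      have hω3 := pow_le_pow_of_le_one hω (bump_le_one R x) (show 1 ≤ 3 by norm_num)
      simp only [h.ev x hx0, src]
      rw [Real.rpow_add (h.u0 x)]
      calc ‖x‖ ^ b * u x ^ q * v x ^ t * u x ^ s * bump R x ^ 3
          = ‖x‖ ^ b * (v x ^ t * (u x ^ q * u x ^ s) * bump R x ^ 3) := by ring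
        _ ≤ (2 ^ |b| * R ^ b) * (v x ^ t * (u x ^ q * u x ^ s) * bump R x ^ 1) := by
          gcongr ?_ * (_ * ?_)
          exact (norm_rpow_le hR hx b).1
    · simp [bump_eq_zero hR hx]
  have e2 : ∫ x, v x ^ (t + 1) * u x ^ s * (C / R ^ 2 * bump R x) =
      C / R ^ 2 * wInt v u (t + 1) s R := by
    rw [wInt, ← integral_const_mul]
    exact integral_congr_ae (Filter.Eventually.of_forall fun x => by ring)
  simp only [pow_one] at e1
  rw [integral_const_mul] at e1
  change _ ≤ _ * wInt v u t (q + s) R at e1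
  rw [e2] at key
  have p1 := wInt_nonneg h.v0 h.u0 t (q + s) hR
  have p2 := wInt_nonneg h.v0 h.u0 (t + 1) s hR
  generalize wInt v u t (q + s) R = I1 at *
  generalize wInt v u (t + 1) s R = I2 at *
  generalize ∫ x, v x ^ (t - 1) * u x ^ s * gdot v v x * bump R x ^ 3 = I3 at *
  have n1 : 0 ≤ R ^ b * I1 := by positivity
  have n2 : 0 ≤ 1 / R ^ 2 * I2 := by positivity
  have key2 : t * I3 ≤ (2 ^ |b| + C') * (R ^ b * I1 + 1 / R ^ 2 * I2) := by
    have e3 : 1 / ((t + 1) * (1 - s)) * (C / R ^ 2 * I2) = C' * (1 / R ^ 2 * I2) := by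
      rw [hC']; ring
    have hb2 : (0 : ℝ) < 2 ^ |b| := by positivity
    rw [e3] at key
    nlinarith [mul_nonneg hC'0.le n1, mul_nonneg hb2.le n2]
  rw [mul_assoc, one_div, ← div_eq_inv_mul, le_div_iff₀ ht]
  linarith

/-- The potential energy density. -/
def _root_.HLE.pot (p q a b : ℝ) (u v : Euc N → ℝ) (x : Euc N) : ℝ :=
  ‖x‖ ^ a * v x ^ (p + 1) / (p + 1) + ‖x‖ ^ b * u x ^ (q + 1) / (q + 1)

lemma pot_nonneg (h : PosSol p q a b u v) (hp : 0 < p) (hq : 0 < q) (x : Euc N) :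
    0 ≤ pot p q a b u v x := by
  have := Real.rpow_pos_of_pos (h.v0 x) (p + 1)
  have := Real.rpow_pos_of_pos (h.u0 x) (q + 1)
  rw [pot]
  positivity

lemma pot_le_dens (h : PosSol p q a b u v) (hp : 0 < p) (hq : 0 < q) (x : Euc N) :
    pot p q a b u v x ≤ dens p q a b u v x := by
  have := Real.rpow_pos_of_pos (h.v0 x) (p + 1)
  have := Real.rpow_pos_of_pos (h.u0 x) (q + 1)
  rw [pot, h.dens_eq]
  exact add_le_add (div_le_self (by positivity) (by linarith))
    (div_le_self (by positivity) (by linarith))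

lemma abs_boundary_le (h : PosSol p q a b u v) (hp : 0 < p) (hq : 0 < q) {s : ℝ} (hs0 : 0 ≤ s)
    (hs1 : s < 1) (c d : ℝ) : ∃ C, 0 < C ∧ ∀ R l : ℝ, 0 < R → 0 < l →
    |∫ x, ∑ i, pd i (fun y => cut R y ^ 4) x * pohozaevField u v (pot p q a b u v) c d i x| ≤
      C * ((∫ x, dens p q a b u v x * bump R x) + l * R ^ b * wInt v u 1 (q + s) R +
        l⁻¹ * R ^ a * wInt v u p (1 - s) R +
        1 / R ^ 2 * (l * wInt v u 2 s R + l⁻¹ * wInt v u 0 (2 - s) R)) := by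
  obtain ⟨C1, hC1, hb⟩ := exists_bound_pow N 2
  obtain ⟨C2, hC2, hg2⟩ := h.weighted_gradient_bound one_pos hs0 hs1
  obtain ⟨C3, hC3, hg3⟩ := h.symm.weighted_gradient_bound (t := 1 - s) (s := 0) (by linarith)
    le_rfl one_pos
  set K := √C1 * (6 + |c| + |d|) with hK
  have hK0 : 0 < K := by positivity
  refine ⟨K * (1 + C2 + C3), by positivity, fun R l hR hl => ?_⟩
  have g2 := hg2 R hR
  have g3 := hg3 R hR
  simp only [sub_self, Real.rpow_zero, one_mul, one_add_one_eq_two] at g2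
  simp only [Real.rpow_zero, mul_one, add_zero, wInt_comm u v, sub_add_eq_add_sub,
    one_add_one_eq_two] at g3
  have hU := isOpen_punctured (N := N)
  have hl' : 0 < l⁻¹ := inv_pos.2 hl
  have i1 : Integrable fun x => u x ^ s * gdot v v x * bump R x ^ 3 :=
    integrable_mul_bump hR ((continuous_rpow h.cu h.u0 s).continuousOn.mul
      (continuousOn_gdot hU h.hv h.hv)) (by simp)
  have i2 : Integrable fun x => u x ^ (1 - s - 1) * gdot u u x * bump R x ^ 3 :=
    integrable_mul_bump hR ((continuous_rpow h.cu h.u0 (1 - s - 1)).continuousOn.mul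
      (continuousOn_gdot hU h.hu h.hu)) (by simp)
  have i3 : Integrable fun x => dens p q a b u v x * bump R x := by
    simpa using h.integrable_dens_bump hR one_ne_zero
  have i4 : Integrable fun x => v x ^ (2 : ℝ) * u x ^ s * bump R x := by
    simpa using h.integrable_wInt 2 s hR one_ne_zero
  have i5 : Integrable fun x => v x ^ (0 : ℝ) * u x ^ (2 - s) * bump R x := by
    simpa using h.integrable_wInt 0 (2 - s) hR one_ne_zero
  set B : Euc N → ℝ := fun x => l * (u x ^ s * gdot v v x * bump R x ^ 3) +
    l⁻¹ * (u x ^ (1 - s - 1) * gdot u u x * bump R x ^ 3) + dens p q a b u v x * bump R x +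
    1 / R ^ 2 * l * (v x ^ (2 : ℝ) * u x ^ s * bump R x) +
    1 / R ^ 2 * l⁻¹ * (v x ^ (0 : ℝ) * u x ^ (2 - s) * bump R x) with hB
  have j1 := i1.const_mul l
  have j2 := i2.const_mul l⁻¹
  have j4 := i4.const_mul (1 / R ^ 2 * l)
  have j5 := i5.const_mul (1 / R ^ 2 * l⁻¹)
  have iB : Integrable B := (((j1.add j2).add i3).add j4).add j5
  have hint : ∫ x, B x = l * (∫ x, u x ^ s * gdot v v x * bump R x ^ 3) +
      l⁻¹ * (∫ x, u x ^ (1 - s - 1) * gdot u u x * bump R x ^ 3) +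
      (∫ x, dens p q a b u v x * bump R x) + 1 / R ^ 2 * l * wInt v u 2 s R +
      1 / R ^ 2 * l⁻¹ * wInt v u 0 (2 - s) R := by
    have s1 := integral_add (((j1.add j2).add i3).add j4) j5
    have s2 := integral_add ((j1.add j2).add i3) j4
    have s3 := integral_add (j1.add j2) i3
    have s4 := integral_add j1 j2
    simp only [Pi.add_apply] at s1 s2 s3
    rw [hB, s1, s2, s3, s4, integral_const_mul, integral_const_mul, integral_const_mul,
      integral_const_mul, wInt, wInt]
  have hbd : ∀ x, ‖∑ i, pd i (fun y => cut R y ^ 4) x *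
      pohozaevField u v (pot p q a b u v) c d i x‖ ≤ K * B x := by
    intro x
    have b1 := (hb R hR x).1
    have hω := bump_nonneg hR x
    have hu := h.u0 x
    have hv := h.v0 x
    rw [Real.norm_eq_abs]
    by_cases hx : x ∈ ann N R
    · have hus := Real.rpow_pos_of_pos hu s
      have e1 : gdot (fun y => cut R y ^ 4) (fun y => cut R y ^ 4) x ≤
          (√C1 / R * bump R x ^ 3) ^ 2 := by
        refine b1.trans_eq ?_
        rw [mul_pow, div_pow, Real.sq_sqrt hC1.le, ← pow_mul]
      refine (abs_sum_pd_mul_pohozaevField_le (w := l * u x ^ s) hR (by positivity)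
        (Real.sqrt_nonneg C1) (pow_nonneg hω 3) e1 hx.2 hu hv (h.pot_nonneg hp hq x)).trans ?_
      rw [hK, hB]
      refine mul_le_mul_of_nonneg_left ?_ (by positivity)
      have hω3 : bump R x ^ 3 ≤ bump R x := by
        simpa using pow_le_pow_of_le_one hω (bump_le_one R x) (show 1 ≤ 3 by norm_num)
      have hpd := h.pot_le_dens hp hq x
      have hd := h.dens_nonneg x
      have e2 : u x ^ (1 - s - 1) = (u x ^ s)⁻¹ := by
        rw [show 1 - s - 1 = -s by ring, Real.rpow_neg hu.le]
      have e3 : u x ^ (2 - s) = (u x ^ s)⁻¹ * u x ^ 2 := by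
        rw [Real.rpow_sub hu, Real.rpow_two, div_eq_inv_mul]
      have m1 : pot p q a b u v x * bump R x ^ 3 ≤ dens p q a b u v x * bump R x := by gcongr
      have m2 : 1 / R ^ 2 * l * (v x ^ 2 * u x ^ s * bump R x ^ 3) ≤
        1 / R ^ 2 * l * (v x ^ 2 * u x ^ s * bump R x) := by gcongr
      have m3 : 1 / R ^ 2 * l⁻¹ * ((u x ^ s)⁻¹ * u x ^ 2 * bump R x ^ 3) ≤
        1 / R ^ 2 * l⁻¹ * ((u x ^ s)⁻¹ * u x ^ 2 * bump R x) := by gcongr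
      rw [mul_inv]
      simp only [e2, e3, Real.rpow_two, Real.rpow_zero, one_mul]
      linarith
    · have e0 : gdot (fun y => cut R y ^ 4) (fun y => cut R y ^ 4) x = 0 :=
        le_antisymm (b1.trans_eq (by simp [bump_eq_zero hR hx])) (gdot_self_nonneg _ _)
      have e1 : ∀ i, pd i (fun y => cut R y ^ 4) x = 0 := fun i => by
        have := (Finset.sum_eq_zero_iff_of_nonneg fun i _ => mul_self_nonneg
          (pd i (fun y : Euc N => cut R y ^ 4) x)).1 e0 i (Finset.mem_univ i)
        exact mul_self_eq_zero.1 this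
      simp [e1, hB, bump_eq_zero hR hx]
  have key := norm_integral_le_of_norm_le (iB.const_mul K) (Filter.Eventually.of_forall hbd)
  rw [Real.norm_eq_abs, integral_const_mul, hint] at key
  refine key.trans ?_
  rw [mul_assoc K (1 + C2 + C3)]
  refine mul_le_mul_of_nonneg_left ?_ hK0.le
  have p0 : 0 ≤ ∫ x, dens p q a b u v x * bump R x :=
    integral_nonneg fun x => mul_nonneg (h.dens_nonneg x) (bump_nonneg hR x)
  have p1 := wInt_nonneg h.v0 h.u0 1 (q + s) hR
  have p2 := wInt_nonneg h.v0 h.u0 p (1 - s) hR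
  have p3 := wInt_nonneg h.v0 h.u0 2 s hR
  have p4 := wInt_nonneg h.v0 h.u0 0 (2 - s) hR
  generalize wInt v u 1 (q + s) R = Q1 at *
  generalize wInt v u p (1 - s) R = Q2 at *
  generalize wInt v u 2 s R = Q3 at *
  generalize wInt v u 0 (2 - s) R = Q4 at *
  generalize ∫ x, dens p q a b u v x * bump R x = D at *
  have k2 := mul_le_mul_of_nonneg_left g2 hl.le
  have k3 := mul_le_mul_of_nonneg_left g3 hl'.le
  have n1 : 0 ≤ l * R ^ b * Q1 := by positivity
  have n2 : 0 ≤ l⁻¹ * R ^ a * Q2 := by positivity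
  have n3 : 0 ≤ 1 / R ^ 2 * (l * Q3) := by positivity
  have n4 : 0 ≤ 1 / R ^ 2 * (l⁻¹ * Q4) := by positivity
  set Z := D + l * R ^ b * Q1 + l⁻¹ * R ^ a * Q2 + 1 / R ^ 2 * (l * Q3 + l⁻¹ * Q4) with hZ
  have z2 : l * (C2 * (R ^ b * Q1 + 1 / R ^ 2 * Q3)) ≤ C2 * Z := by
    rw [show l * (C2 * (R ^ b * Q1 + 1 / R ^ 2 * Q3)) =
      C2 * (l * R ^ b * Q1 + 1 / R ^ 2 * (l * Q3)) by ring]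
    exact mul_le_mul_of_nonneg_left (by rw [hZ]; linarith) hC2.le
  have z3 : l⁻¹ * (C3 * (R ^ a * Q2 + 1 / R ^ 2 * Q4)) ≤ C3 * Z := by
    rw [show l⁻¹ * (C3 * (R ^ a * Q2 + 1 / R ^ 2 * Q4)) =
      C3 * (l⁻¹ * R ^ a * Q2 + 1 / R ^ 2 * (l⁻¹ * Q4)) by ring]
    exact mul_le_mul_of_nonneg_left (by rw [hZ]; linarith) hC3.le
  have z1 : D + 1 / R ^ 2 * l * Q3 + 1 / R ^ 2 * l⁻¹ * Q4 ≤ Z := by rw [hZ]; linarith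
  linarith

end PosSol

/-! ### Vanishing of the boundary terms -/

/-- The flux of the Pohozaev field through the annulus of radius `R`. -/
def flux (p q a b : ℝ) (u v : Euc N → ℝ) (c d R : ℝ) : ℝ :=
  ∫ x, ∑ i, pd i (fun y => cut R y ^ 4) x * pohozaevField u v (pot p q a b u v) c d i x

namespace PosSol

variable {p q a b : ℝ} {u v : Euc N → ℝ}

lemma rpow_mul_wInt_le (h : PosSol p q a b u v) {e α β γ r s t : ℝ}
    (hα : 0 ≤ α) (hβ : 0 ≤ β) (hγ : 0 ≤ γ) (h1 : α + β + γ = 1)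
    (hr : r = a * α + b * β + e * γ) (hs : s = (p + 1) * α) (ht : t = (q + 1) * β)
    {R : ℝ} (hR : 0 < R) :
    R ^ r * wInt v u s t R ≤ 2 ^ (|a| + |b|) * (∫ x, dens p q a b u v x * bump R x) +
        (∫ x : Euc N, bump 1 x) * R ^ (e + N) := by
  have ib : Integrable fun x : Euc N => bump R x := by
    simpa using integrable_mul_bump (N := N) (F := fun _ => 1) hR continuousOn_const one_ne_zero
  have id : Integrable fun x => dens p q a b u v x * bump R x := by
    simpa using h.integrable_dens_bump hR one_ne_zero
  have im : Integrable fun x => v x ^ s * u x ^ t * bump R x := by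
    simpa using h.integrable_wInt s t hR one_ne_zero
  have key : ∫ x, R ^ r * (v x ^ s * u x ^ t * bump R x) ≤
      ∫ x, (2 ^ (|a| + |b|) * (dens p q a b u v x * bump R x) + R ^ e * bump R x) := by
    refine integral_mono (im.const_mul _) ((id.const_mul _).add (ib.const_mul _)) fun x => ?_
    by_cases hx : x ∈ ann N R
    · have hω := bump_nonneg hR x
      have hm := young_monomial hR (h.u0 x) (h.v0 x) hα hβ hγ h1 hr hs ht
      have hd := h.monomials_le_dens hR hx
      calc _ = R ^ r * v x ^ s * u x ^ t * bump R x := by ring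
        _ ≤ (2 ^ (|a| + |b|) * dens p q a b u v x + R ^ e) * bump R x := by
          gcongr; linarith
        _ = _ := by ring
    · simp [bump_eq_zero hR hx]
  rw [integral_add (id.const_mul _) (ib.const_mul _), integral_const_mul, integral_const_mul,
    integral_const_mul, integral_bump hR] at key
  rw [Real.rpow_add hR, Real.rpow_natCast, wInt]
  linarith

lemma abs_flux_le_dens (h : PosSol p q a b u v) (hq : 0 < q) (hpq : q < p) {θ e : ℝ}
    (hθ : θ = 1 - 1 / (p + 1) - 1 / (q + 1)) (hθ0 : 0 ≤ θ)
    (he : e * θ = -2 - a / (p + 1) - b / (q + 1)) (c d : ℝ) :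
    ∃ C, 0 < C ∧ ∀ R : ℝ, 0 < R →
      |flux p q a b u v c d R| ≤ C * ((∫ x, dens p q a b u v x * bump R x) + R ^ (e + N)) := by
  have hp : 0 < p := hq.trans hpq
  have hp0 : p + 1 ≠ 0 := by positivity
  have hq0 : q + 1 ≠ 0 := by positivity
  obtain ⟨C, hC, hb⟩ := h.abs_boundary_le hp hq (s := (p - q) / (p + 1))
    (div_nonneg (by linarith) (by linarith)) ((div_lt_one (by linarith)).2 (by linarith)) c d
  set A : ℝ := 2 ^ (|a| + |b|) with hA
  have hA0 : 0 < A := by positivity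
  set J := ∫ x : Euc N, bump 1 x with hJ
  have hJ0 : 0 ≤ J := integral_nonneg fun x => bump_nonneg one_pos x
  have ht : 0 < 1 / (p + 1) := by positivity
  have hts : 1 / (p + 1) ≤ 1 / (q + 1) := one_div_le_one_div_of_le (by linarith) (by linarith)
  have ht1 : 1 / (p + 1) ≤ 1 := (div_le_one (by linarith)).2 (by linarith)
  refine ⟨C * (1 + 4 * A + 4 * J), by positivity, fun R hR => (hb R (R ^ ((a - b) / (p + 1))) hR
    (Real.rpow_pos_of_pos hR _)).trans ?_⟩
  have y1 := h.rpow_mul_wInt_le (e := e) (α := 1 / (p + 1)) (β := 1 - 1 / (p + 1)) (γ := 0)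
    (r := (a - b) / (p + 1) + b) (s := 1) (t := q + (p - q) / (p + 1)) ht.le (by linarith) le_rfl
    (by ring) (by field_simp; ring) (by field_simp) (by field_simp; ring) hR
  have y2 := h.rpow_mul_wInt_le (e := e) (α := 1 - 1 / (p + 1)) (β := 1 / (p + 1)) (γ := 0)
    (r := -((a - b) / (p + 1)) + a) (s := p) (t := 1 - (p - q) / (p + 1)) (by linarith) ht.le le_rfl
    (by ring) (by field_simp; ring) (by field_simp; ring) (by field_simp; ring) hR
  have y3 := h.rpow_mul_wInt_le (e := e) (α := 2 * (1 / (p + 1))) (β := 1 / (q + 1) - 1 / (p + 1))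
    (γ := θ) (r := (a - b) / (p + 1) + -2) (s := 2) (t := (p - q) / (p + 1)) (by linarith)
    (by linarith) hθ0 (by linarith) (by rw [he]; ring) (by field_simp)
    (by field_simp; ring) hR
  have y4 := h.rpow_mul_wInt_le (e := e) (α := 0) (β := 1 / (q + 1) + 1 / (p + 1))
    (γ := θ) (r := -((a - b) / (p + 1)) + -2) (s := 0) (t := 2 - (p - q) / (p + 1)) le_rfl
    (by linarith) hθ0 (by linarith) (by rw [he]; ring) (by simp)
    (by field_simp; ring) hR
  rw [Real.rpow_add hR] at y1 y2 y3 y4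
  rw [Real.rpow_neg hR.le] at y2 y4
  have e2 : 1 / R ^ 2 = R ^ (-2 : ℝ) := by rw [Real.rpow_neg hR.le, Real.rpow_two, one_div]
  rw [mul_assoc C, e2]
  refine mul_le_mul_of_nonneg_left ?_ hC.le
  have d0 : 0 ≤ ∫ x, dens p q a b u v x * bump R x :=
    integral_nonneg fun x => mul_nonneg (h.dens_nonneg x) (bump_nonneg hR x)
  have d1 : 0 < R ^ (e + N) := by positivity
  generalize ∫ x, dens p q a b u v x * bump R x = D at *
  generalize R ^ (e + N) = E at *
  nlinarith [mul_nonneg hA0.le d0, mul_nonneg hJ0 d0, mul_nonneg hA0.le d1.le]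

lemma wInt_le_pow (h : PosSol p q a b u v) (s t : ℝ) : ∃ K, 0 ≤ K ∧ ∀ R : ℝ, 0 < R → R ≤ 1 →
    wInt v u s t R ≤ K * R ^ N := by
  have hc := (continuous_rpow h.cv h.v0 s).mul (continuous_rpow h.cu h.u0 t)
  obtain ⟨K, hK⟩ := (isCompact_closedBall (0 : Euc N) 2).exists_bound_of_continuousOn hc.continuousOn
  have hJ0 : 0 ≤ ∫ x : Euc N, bump 1 x := integral_nonneg fun x => bump_nonneg one_pos x
  have hK0 : 0 ≤ K := (norm_nonneg _).trans (hK 0 (by simp))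
  refine ⟨K * ∫ x : Euc N, bump 1 x, by positivity, fun R hR hR1 => ?_⟩
  have ib : Integrable fun x : Euc N => bump R x := by
    simpa using integrable_mul_bump (N := N) (F := fun _ => 1) hR continuousOn_const one_ne_zero
  have im : Integrable fun x => v x ^ s * u x ^ t * bump R x := by
    simpa using h.integrable_wInt s t hR one_ne_zero
  have key : wInt v u s t R ≤ ∫ x : Euc N, K * bump R x := by
    refine integral_mono im (ib.const_mul _) fun x => ?_
    by_cases hx : x ∈ ann N R
    · have := hK x (by simpa using hx.2.trans (by linarith))
      have hω := bump_nonneg hR x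
      exact mul_le_mul_of_nonneg_right ((le_abs_self _).trans this) hω
    · simp [bump_eq_zero hR hx]
  rw [integral_const_mul, integral_bump hR] at key
  linarith

lemma integral_dens_bump_le (h : PosSol p q a b u v) {R : ℝ} (hR : 0 < R) :
    ∫ x, dens p q a b u v x * bump R x ≤
      2 ^ |a| * R ^ a * wInt v u (p + 1) 0 R + 2 ^ |b| * R ^ b * wInt v u 0 (q + 1) R := by
  have i1 : Integrable fun x => v x ^ (p + 1) * u x ^ (0 : ℝ) * bump R x := by
    simpa using h.integrable_wInt (p + 1) 0 hR one_ne_zero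
  have i2 : Integrable fun x => v x ^ (0 : ℝ) * u x ^ (q + 1) * bump R x := by
    simpa using h.integrable_wInt 0 (q + 1) hR one_ne_zero
  rw [wInt, wInt, ← integral_const_mul, ← integral_const_mul,
    ← integral_add (i1.const_mul _) (i2.const_mul _)]
  refine integral_mono (by simpa using h.integrable_dens_bump hR one_ne_zero)
    ((i1.const_mul _).add (i2.const_mul _)) fun x => ?_
  by_cases hx : x ∈ ann N R
  · have hω := bump_nonneg hR x
    have hv := Real.rpow_pos_of_pos (h.v0 x) (p + 1)
    have hu := Real.rpow_pos_of_pos (h.u0 x) (q + 1)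
    have ha := (norm_rpow_le hR hx a).1
    have hb := (norm_rpow_le hR hx b).1
    simp only [h.dens_eq, Real.rpow_zero, mul_one, one_mul]
    calc _ ≤ (2 ^ |a| * R ^ a * v x ^ (p + 1) + 2 ^ |b| * R ^ b * u x ^ (q + 1)) * bump R x := by
          gcongr
      _ = _ := by ring
  · simp [bump_eq_zero hR hx]

lemma abs_flux_le_pow (h : PosSol p q a b u v) (hq : 0 < q) (hpq : q < p) (c d : ℝ) :
    ∃ C, 0 ≤ C ∧ ∀ R : ℝ, 0 < R → R ≤ 1 →
      |flux p q a b u v c d R| ≤ C * (R ^ (N + a) + R ^ (N + b) + R ^ ((N : ℝ) - 2)) := by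
  obtain ⟨C, hC, hb⟩ := h.abs_boundary_le (hq.trans hpq) hq (s := (p - q) / (p + 1))
    (div_nonneg (by linarith) (by linarith)) ((div_lt_one (by linarith)).2 (by linarith)) c d
  set s := (p - q) / (p + 1) with hs
  obtain ⟨K1, hK1, h1⟩ := h.wInt_le_pow (p + 1) 0
  obtain ⟨K2, hK2, h2⟩ := h.wInt_le_pow 0 (q + 1)
  obtain ⟨K3, hK3, h3⟩ := h.wInt_le_pow 1 (q + s)
  obtain ⟨K4, hK4, h4⟩ := h.wInt_le_pow p (1 - s)
  obtain ⟨K5, hK5, h5⟩ := h.wInt_le_pow 2 s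
  obtain ⟨K6, hK6, h6⟩ := h.wInt_le_pow 0 (2 - s)
  set A : ℝ := 2 ^ |a| with hA
  set B : ℝ := 2 ^ |b| with hB
  have hA0 : 0 < A := by positivity
  have hB0 : 0 < B := by positivity
  refine ⟨C * (A * K1 + B * K2 + K3 + K4 + K5 + K6), by positivity, fun R hR hR1 =>
    (hb R 1 hR one_pos).trans ?_⟩
  rw [mul_assoc C]
  refine mul_le_mul_of_nonneg_left ?_ hC.le
  have hD := h.integral_dens_bump_le hR
  rw [← hA, ← hB] at hD
  simp only [inv_one, one_mul]
  have e1 : R ^ ((N : ℝ) - 2) = 1 / R ^ 2 * R ^ N := by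
    rw [Real.rpow_sub hR, Real.rpow_natCast, Real.rpow_two]; ring
  rw [e1, Real.rpow_add hR, Real.rpow_add hR, Real.rpow_natCast]
  have n1 := mul_le_mul_of_nonneg_left (h1 R hR hR1) (show 0 ≤ A * R ^ a by positivity)
  have n2 := mul_le_mul_of_nonneg_left (h2 R hR hR1) (show 0 ≤ B * R ^ b by positivity)
  have n3 := mul_le_mul_of_nonneg_left (h3 R hR hR1) (show 0 ≤ R ^ b by positivity)
  have n4 := mul_le_mul_of_nonneg_left (h4 R hR hR1) (show 0 ≤ R ^ a by positivity)
  have n5 := mul_le_mul_of_nonneg_left (h5 R hR hR1) (show 0 ≤ 1 / R ^ 2 by positivity)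
  have n6 := mul_le_mul_of_nonneg_left (h6 R hR hR1) (show 0 ≤ 1 / R ^ 2 by positivity)
  have P1 : 0 ≤ R ^ N * R ^ a := by positivity
  have P2 : 0 ≤ R ^ N * R ^ b := by positivity
  have P3 : 0 ≤ 1 / R ^ 2 * R ^ N := by positivity
  set X := R ^ N * R ^ a with hX
  set Y := R ^ N * R ^ b with hY
  set Z := 1 / R ^ 2 * R ^ N with hZ
  calc _ ≤ A * K1 * X + B * K2 * Y + K3 * Y + K4 * X + (K5 + K6) * Z := by
        rw [hX, hY, hZ]; linarith
    _ ≤ A * K1 * (X + Y + Z) + B * K2 * (X + Y + Z) + K3 * (X + Y + Z) + K4 * (X + Y + Z) +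
        (K5 + K6) * (X + Y + Z) := by
      gcongr <;> linarith
    _ = _ := by ring

end PosSol

/-! ### The energy identity -/

lemma xd_eq_fderiv (f : Euc N → ℝ) (x : Euc N) : xd f x = fderiv ℝ f x x := by
  have hx := (EuclideanSpace.basisFun (Fin N) ℝ).sum_repr x
  have h := congrArg (fderiv ℝ f x) hx
  simpa [xd, pd] using h

lemma xd_norm_rpow {x : Euc N} (hx : x ≠ 0) (a : ℝ) :
    xd (fun y : Euc N => ‖y‖ ^ a) x = a * ‖x‖ ^ a := by
  have hd : DifferentiableAt ℝ (fun y : Euc N => ‖y‖) x := differentiableAt_id.norm ℝ hx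
  have hn : 0 < ‖x‖ := norm_pos_iff.2 hx
  have h1 : xd (fun y : Euc N => ‖y‖) x = ‖x‖ := by
    rw [xd_eq_fderiv, hd.fderiv_norm_self]
  have h2 : xd (fun y : Euc N => ‖y‖ ^ a) x =
      a * ‖x‖ ^ (a - 1) * xd (fun y : Euc N => ‖y‖) x := by
    simp only [xd, pd_rpow hd hn, Finset.mul_sum]
    exact Finset.sum_congr rfl fun j _ => by ring
  rw [h2, h1, Real.rpow_sub_one hn.ne']
  field_simp

lemma contDiffAt_norm_rpow_mul {v : Euc N → ℝ} {x : Euc N} (hx : x ≠ 0)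
    (hv : ContDiffAt ℝ 2 v x) (h0 : 0 < v x) (a s : ℝ) :
    ContDiffAt ℝ 2 (fun y => ‖y‖ ^ a * v y ^ s) x :=
  ((contDiffAt_norm ℝ hx).rpow_const_of_ne (norm_ne_zero_iff.2 hx)).mul
    (hv.rpow_const_of_ne h0.ne')

lemma xd_norm_rpow_mul {v : Euc N → ℝ} {x : Euc N} (hx : x ≠ 0) (hv : ContDiffAt ℝ 2 v x)
    (h0 : 0 < v x) (a p : ℝ) : xd (fun y => ‖y‖ ^ a * v y ^ (p + 1)) x =
      a * (src a p v x * v x) + (p + 1) * (src a p v x * xd v x) := by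
  have hn : DifferentiableAt ℝ (fun y : Euc N => ‖y‖ ^ a) x :=
    ((contDiffAt_norm ℝ (n := 2) hx).rpow_const_of_ne
      (norm_ne_zero_iff.2 hx)).differentiableAt (by simp)
  have hvd : DifferentiableAt ℝ v x := hv.differentiableAt (by simp)
  have hvp : DifferentiableAt ℝ (fun y => v y ^ (p + 1)) x :=
    hvd.rpow_const (Or.inl h0.ne')
  have h1 : xd (fun y => ‖y‖ ^ a * v y ^ (p + 1)) x =
      ‖x‖ ^ a * ((p + 1) * v x ^ p) * xd v x +
        v x ^ (p + 1) * xd (fun y : Euc N => ‖y‖ ^ a) x := by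
    simp only [xd, pd_mul hn hvp, pd_rpow hvd h0, Finset.mul_sum, ← Finset.sum_add_distrib,
      add_sub_cancel_right]
    exact Finset.sum_congr rfl fun j _ => by ring
  rw [h1, xd_norm_rpow hx, src, Real.rpow_add_one h0.ne']
  ring

namespace PosSol

variable {p q a b : ℝ} {u v : Euc N → ℝ}

lemma contDiffOn_pot (h : PosSol p q a b u v) :
    ContDiffOn ℝ 1 (pot p q a b u v) {x | x ≠ 0} := fun x hx => by
  have hU := isOpen_punctured.mem_nhds hx
  have h1 := contDiffAt_norm_rpow_mul hx (h.hv.contDiffAt hU) (h.v0 x) a (p + 1)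
  have h2 := contDiffAt_norm_rpow_mul hx (h.hu.contDiffAt hU) (h.u0 x) b (q + 1)
  exact (((h1.div_const _).add (h2.div_const _)).of_le (by norm_num)).contDiffWithinAt

lemma xd_pot (h : PosSol p q a b u v) (hp : 0 < p) (hq : 0 < q) {x : Euc N} (hx : x ≠ 0) :
    N * pot p q a b u v x + xd (pot p q a b u v) x =
      ((N + a) / (p + 1) * (src a p v x * v x) + (N + b) / (q + 1) * (src b q u x * u x)) +
        src a p v x * xd v x + src b q u x * xd u x := by
  have hU := isOpen_punctured.mem_nhds hx
  have c1 := contDiffAt_norm_rpow_mul hx (h.hv.contDiffAt hU) (h.v0 x) a (p + 1)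
  have c2 := contDiffAt_norm_rpow_mul hx (h.hu.contDiffAt hU) (h.u0 x) b (q + 1)
  have d1 := c1.differentiableAt (by simp)
  have d2 := c2.differentiableAt (by simp)
  have e1 := xd_norm_rpow_mul hx (h.hv.contDiffAt hU) (h.v0 x) a p
  have e2 := xd_norm_rpow_mul hx (h.hu.contDiffAt hU) (h.u0 x) b q
  have hpot : pot p q a b u v = fun y => (p + 1)⁻¹ * (‖y‖ ^ a * v y ^ (p + 1)) +
      (q + 1)⁻¹ * (‖y‖ ^ b * u y ^ (q + 1)) := by
    funext y
    rw [pot]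
    ring
  have hxd : xd (pot p q a b u v) x = (p + 1)⁻¹ * xd (fun y => ‖y‖ ^ a * v y ^ (p + 1)) x +
      (q + 1)⁻¹ * xd (fun y => ‖y‖ ^ b * u y ^ (q + 1)) x := by
    rw [hpot]
    simp only [xd, pd_add (d1.const_mul (p + 1)⁻¹) (d2.const_mul (q + 1)⁻¹), pd_const_mul d1,
      pd_const_mul d2, Finset.mul_sum, ← Finset.sum_add_distrib]
    exact Finset.sum_congr rfl fun j _ => by ring
  have m1 : ‖x‖ ^ a * v x ^ (p + 1) = src a p v x * v x := by
    rw [src, Real.rpow_add_one (h.v0 x).ne']; ring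
  have m2 : ‖x‖ ^ b * u x ^ (q + 1) = src b q u x * u x := by
    rw [src, Real.rpow_add_one (h.u0 x).ne']; ring
  rw [hxd, e1, e2, pot, m1, m2]
  have hp0 : p + 1 ≠ 0 := by positivity
  have hq0 : q + 1 ≠ 0 := by positivity
  field_simp
  ring

lemma integrable_flux (h : PosSol p q a b u v) (c d : ℝ) {R : ℝ} (hR : 0 < R) :
    Integrable fun x => ∑ i, pd i (fun y => cut R y ^ 4) x *
      pohozaevField u v (pot p q a b u v) c d i x := by
  obtain ⟨C, hC, hb⟩ := exists_bound_pow N 2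
  have hcut : ContDiff ℝ 2 fun y : Euc N => cut R y ^ 4 := (cut_contDiff R (n := 2)).pow 4
  refine integrable_of_continuousOn (isCompact_ann R) (ContinuousOn.mono ?_ (ann_subset hR))
    fun x hx => ?_
  · refine continuousOn_finsetSum _ fun i _ =>
      (continuousOn_pd isOpen_punctured hcut.contDiffOn i).mul fun x hx => ?_
    have hU := isOpen_punctured.mem_nhds hx
    exact (contDiffAt_pohozaevField (h.hu.contDiffAt hU) (h.hv.contDiffAt hU)
      (h.contDiffOn_pot.contDiffAt hU) c d i).continuousAt.continuousWithinAt
  · have e0 : gdot (fun y => cut R y ^ 4) (fun y => cut R y ^ 4) x = 0 :=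
      le_antisymm ((hb R hR x).1.trans_eq (by simp [bump_eq_zero hR hx])) (gdot_self_nonneg _ _)
    refine Finset.sum_eq_zero fun i _ => ?_
    rw [mul_self_eq_zero.1 ((Finset.sum_eq_zero_iff_of_nonneg fun i _ => mul_self_nonneg
      (pd i (fun y : Euc N => cut R y ^ 4) x)).1 e0 i (Finset.mem_univ i)), zero_mul]

lemma energy_identity (h : PosSol p q a b u v) (hp : 0 < p) (hq : 0 < q) {δ : ℝ}
    (hδ : (N + a) / (p + 1) + (N + b) / (q + 1) = N - 2 + δ) {ε R : ℝ} (hε : 0 < ε)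
    (hR : 2 * ε ≤ R) :
    Integrable (fun x => dens p q a b u v x * (cut R x ^ 4 - cut ε x ^ 4)) ∧
    δ / 2 * ∫ x, dens p q a b u v x * (cut R x ^ 4 - cut ε x ^ 4) =
      flux p q a b u v ((N + a) / (p + 1) - δ / 2) ((N + b) / (q + 1) - δ / 2) ε -
      flux p q a b u v ((N + a) / (p + 1) - δ / 2) ((N + b) / (q + 1) - δ / 2) R := by
  have hR0 : 0 < R := by linarith
  set c := (N + a) / (p + 1) - δ / 2 with hc
  set d := (N + b) / (q + 1) - δ / 2 with hd
  have hSU : {x : Euc N | ε ≤ ‖x‖ ∧ ‖x‖ ≤ 2 * R} ⊆ {x | x ≠ 0} := fun x hx hx0 => by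
    have := hx.1
    rw [hx0, norm_zero] at this
    linarith
  have hcut : ∀ ρ : ℝ, ContDiff ℝ 1 fun y : Euc N => cut ρ y ^ 4 := fun ρ =>
    (cut_contDiff ρ (n := 1)).pow 4
  have h0 : ∀ x ∉ {x : Euc N | ε ≤ ‖x‖ ∧ ‖x‖ ≤ 2 * R}, cut R x ^ 4 - cut ε x ^ 4 = 0 := by
    intro x hx
    simp only [mem_ofPred_eq, not_and_or, not_le] at hx
    rcases hx with hx | hx
    · rw [cut_eq_one hR0 (by linarith), cut_eq_one hε hx.le]; simp
    · rw [cut_eq_zero hR0 hx.le, cut_eq_zero hε (by linarith)]; simp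
  have hint : Integrable (fun x => dens p q a b u v x * (cut R x ^ 4 - cut ε x ^ 4)) :=
    integrable_of_continuousOn (isCompact_annulus ε (2 * R))
      ((h.continuousOn_dens.mono hSU).mul ((hcut R).continuous.sub (hcut ε).continuous).continuousOn)
      fun x hx => by rw [h0 x hx, mul_zero]
  have key := integral_pohozaev (η := fun x => cut R x ^ 4 - cut ε x ^ 4)
    (κ := fun x => (N + a) / (p + 1) * (src a p v x * v x) +
      (N + b) / (q + 1) * (src b q u x * u x))
    isOpen_punctured (isCompact_annulus ε (2 * R)) hSU h.hu h.hv h.contDiffOn_pot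
    ((hcut R).sub (hcut ε)).contDiffOn h0 (fun x hx => h.eu x hx) (fun x hx => h.ev x hx)
    (fun x hx => h.xd_pot hp hq hx) (c := c) (d := d) (by rw [hc, hd]; linarith)
  have e1 : ∀ x, (cut R x ^ 4 - cut ε x ^ 4) * ((N + a) / (p + 1) * (src a p v x * v x) +
      (N + b) / (q + 1) * (src b q u x * u x) - c * (src a p v x * v x) -
        d * (src b q u x * u x)) +
      ∑ i, pd i (fun x => cut R x ^ 4 - cut ε x ^ 4) x *
        pohozaevField u v (pot p q a b u v) c d i x =
      δ / 2 * (dens p q a b u v x * (cut R x ^ 4 - cut ε x ^ 4)) +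
      ((∑ i, pd i (fun y => cut R y ^ 4) x * pohozaevField u v (pot p q a b u v) c d i x) -
        ∑ i, pd i (fun y => cut ε y ^ 4) x * pohozaevField u v (pot p q a b u v) c d i x) := by
    intro x
    rw [← Finset.sum_sub_distrib]
    congr 1
    · rw [dens, hc, hd]; ring
    · refine Finset.sum_congr rfl fun i _ => ?_
      rw [pd_sub ((hcut R).differentiable (by simp) x) ((hcut ε).differentiable (by simp) x)]
      ring
  simp only [e1] at key
  have iR := h.integrable_flux c d hR0
  have iε := h.integrable_flux c d hε
  have s1 := integral_add (hint.const_mul (δ / 2)) (iR.sub iε)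
  simp only [Pi.sub_apply] at s1
  rw [s1, integral_sub iR iε, integral_const_mul] at key
  refine ⟨hint, ?_⟩
  rw [flux, flux]
  linarith

lemma integral_dens_bump_one_pos (h : PosSol p q a b u v) (hN : 0 < N) :
    0 < ∫ x, dens p q a b u v x * bump 1 x := by
  have hi : Integrable fun x => dens p q a b u v x * bump 1 x := by
    simpa using h.integrable_dens_bump one_pos one_ne_zero
  rw [integral_pos_iff_support_of_nonneg
    (fun x => mul_nonneg (h.dens_nonneg x) (bump_nonneg one_pos x)) hi]
  have ho : IsOpen {x : Euc N | bump 1 x ≠ 0} :=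
    isOpen_ne.preimage (bump_contDiff 1 (n := 0)).continuous
  refine (ho.measure_pos volume ⟨EuclideanSpace.single ⟨0, hN⟩ 1, ?_⟩).trans_le
    (measure_mono fun x hx => ?_)
  · have hn : ‖(EuclideanSpace.single ⟨0, hN⟩ 1 : Euc N)‖ = 1 := by simp
    rw [mem_ofPred_eq, bump_eq_cut one_pos hn.ge, cut_eq_one one_pos hn.le]
    exact one_ne_zero
  · have hx0 : x ≠ 0 := by
      rintro rfl
      exact hx (bump_eq_zero one_pos fun h0 => ann_subset one_pos h0 rfl)
    exact mul_ne_zero (h.dens_pos hx0).ne' hx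

lemma integral_dens_bump_one_le (h : PosSol p q a b u v) (hp : 0 < p) (hq : 0 < q) {δ : ℝ}
    (hδ0 : 0 < δ) (hδ : (N + a) / (p + 1) + (N + b) / (q + 1) = N - 2 + δ) {ε R : ℝ} (hε : 0 < ε)
    (hε1 : ε ≤ 1 / 4) (hR : 2 ≤ R) :
    δ / 2 * ∫ x, dens p q a b u v x * bump 1 x ≤
      |flux p q a b u v ((N + a) / (p + 1) - δ / 2) ((N + b) / (q + 1) - δ / 2) ε| +
      |flux p q a b u v ((N + a) / (p + 1) - δ / 2) ((N + b) / (q + 1) - δ / 2) R| := by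
  obtain ⟨hi, he⟩ := h.energy_identity hp hq hδ hε (R := R) (by linarith)
  refine le_trans ?_ ((he.trans_le (le_abs_self _)).trans (abs_sub _ _))
  refine mul_le_mul_of_nonneg_left (integral_mono
    (by simpa using h.integrable_dens_bump one_pos one_ne_zero) hi fun x =>
    mul_le_mul_of_nonneg_left ?_ (h.dens_nonneg x)) (by linarith)
  by_cases hx : x ∈ ann N 1
  · obtain ⟨h1, h2⟩ := hx
    rw [cut_eq_one (by linarith) (by linarith), cut_eq_zero hε (by linarith)]
    simpa using bump_le_one 1 x
  · rw [bump_eq_zero one_pos hx, sub_nonneg]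
    refine pow_le_pow_left₀ (cut_nonneg ε x) ?_ 4
    rcases le_total ‖x‖ R with hx' | hx'
    · rw [cut_eq_one (by linarith) hx']; exact cut_le_one ε x
    · rw [cut_eq_zero hε (by linarith)]; exact cut_nonneg R x

end PosSol

lemma PosSol.not_stableOutside {p q a b : ℝ} {u v : Euc N → ℝ} (h : PosSol p q a b u v)
    (hN : 3 ≤ N) (hq0 : 0 < q) (hq1 : q < 1) (hpq : 1 < p * q) (ha : -2 < a) (hb : -2 < b)
    (hsub : (N : ℝ) - 2 < (N + a) / (p + 1) + (N + b) / (q + 1)) {K : Set (Euc N)} :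
    ¬ HLEStableOutside p q a b u v K := by
  intro hK
  have hp : 1 < p := by nlinarith
  have hN' : (3 : ℝ) ≤ N := by exact_mod_cast hN
  have hp1 : 0 < p + 1 := by linarith
  have hq2 : 0 < q + 1 := by linarith
  obtain ⟨δ, hδ⟩ : ∃ δ, δ = (N + a) / (p + 1) + (N + b) / (q + 1) - (N - 2) := ⟨_, rfl⟩
  have hδ0 : 0 < δ := by linarith
  obtain ⟨θ, hθ⟩ : ∃ θ, θ = 1 - 1 / (p + 1) - 1 / (q + 1) := ⟨_, rfl⟩
  have hθ0 : 0 < θ := by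
    have : θ = (p * q - 1) / ((p + 1) * (q + 1)) := by rw [hθ]; field_simp; ring
    rw [this]
    exact div_pos (by linarith) (by positivity)
  obtain ⟨e, he⟩ : ∃ e, e * θ = -2 - a / (p + 1) - b / (q + 1) :=
    ⟨_, div_mul_cancel₀ _ hθ0.ne'⟩
  have heN : e + N < 0 := by
    have : (e + N) * θ = -δ := by rw [add_mul, he, hθ, hδ]; ring
    by_contra! hc
    linarith [mul_nonneg hc hθ0.le]
  obtain ⟨k, r, M, hr, hM⟩ := h.integral_dens_bounded hp hq0 hq1 hpq hK hθ hθ0 he heN.le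
  have hlim := h.tendsto_integral_dens_bump hr hM
  set c := (N + a) / (p + 1) - δ / 2 with hc
  set d := (N + b) / (q + 1) - δ / 2 with hd
  obtain ⟨C₁, hC₁, hf₁⟩ := h.abs_flux_le_dens hq0 (by linarith) hθ hθ0.le he c d
  obtain ⟨C₂, hC₂, hf₂⟩ := h.abs_flux_le_pow hq0 (by linarith) c d
  have hR : Filter.Tendsto (fun j : ℕ => (2 : ℝ) ^ (j + 1) * (2 * r)) Filter.atTop Filter.atTop :=
    ((tendsto_pow_atTop_atTop_of_one_lt one_lt_two).comp
      (Filter.tendsto_add_atTop_nat 1)).atTop_mul_const (by positivity)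
  have hRe : Filter.Tendsto (fun j : ℕ => ((2 : ℝ) ^ (j + 1) * (2 * r)) ^ (e + N)) Filter.atTop
      (nhds 0) := by
    have := (tendsto_rpow_neg_atTop (y := -(e + N)) (by linarith)).comp hR
    simpa [Function.comp_def] using this
  have hflux : Filter.Tendsto (fun j : ℕ => |flux p q a b u v c d (2 ^ (j + 1) * (2 * r))|)
      Filter.atTop (nhds 0) := by
    refine squeeze_zero (fun j => abs_nonneg _) (fun j => hf₁ _ (by positivity)) ?_
    simpa using (hlim.add hRe).const_mul C₁
  have hε : ∀ ε : ℝ, 0 < ε → ε ≤ 1 / 4 →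
      δ / 2 * ∫ x, dens p q a b u v x * bump 1 x ≤ |flux p q a b u v c d ε| := by
    intro ε hε hε1
    refine ge_of_tendsto (by simpa using hflux.const_add |flux p q a b u v c d ε|) ?_
    filter_upwards [hR.eventually_ge_atTop 2] with j hj
    exact h.integral_dens_bump_one_le (by linarith) hq0 hδ0 (by linarith) hε hε1 hj
  have hpow : ∀ s : ℝ, 0 < s → Filter.Tendsto (fun ε : ℝ => ε ^ s) (nhdsWithin 0 (Ioi 0))
      (nhds 0) := by
    intro s hs
    have := (Real.continuousAt_rpow_const 0 s (Or.inr hs.le)).tendsto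
    rw [Real.zero_rpow hs.ne'] at this
    exact this.mono_left nhdsWithin_le_nhds
  have hlim0 : Filter.Tendsto (fun ε : ℝ => C₂ * (ε ^ (N + a) + ε ^ (N + b) + ε ^ ((N : ℝ) - 2)))
      (nhdsWithin 0 (Ioi 0)) (nhds 0) := by
    simpa using (((hpow (N + a) (by linarith)).add (hpow (N + b) (by linarith))).add
      (hpow (N - 2) (by linarith))).const_mul C₂
  have hpos := h.integral_dens_bump_one_pos (by lia)
  have hle : δ / 2 * ∫ x, dens p q a b u v x * bump 1 x ≤ 0 := by
    refine ge_of_tendsto hlim0 ?_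
    filter_upwards [Ioc_mem_nhdsGT (show (0 : ℝ) < 1 / 4 by norm_num)] with ε hε'
    exact (hε ε hε'.1 hε'.2).trans (hf₂ ε hε'.1 (by linarith [hε'.2]))
  linarith [mul_pos (half_pos hδ0) hpos]

end HLE

/-- Theorem 3.21: for `0 < q < 1 < 1/q < p`, `a, b > -2` and `(p,q,a,b)` subcritical, the
Hénon–Lane–Emden system admits no positive solution stable outside a compact set. -/
theorem stmt_11 (N : ℕ) (hN : 3 ≤ N) (p q a b : ℝ)
    (hq0 : 0 < q) (hq1 : q < 1) (hp : 1 / q < p)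
    (ha : -2 < a) (hb : -2 < b)
    (hsub : ((N : ℝ) + a) / (p + 1) + ((N : ℝ) + b) / (q + 1) > (N : ℝ) - 2) :
    ¬ ∃ (u v : Euc N → ℝ) (K : Set (Euc N)),
        IsHLESol p q a b u v ∧ (∀ x, 0 < u x) ∧ (∀ x, 0 < v x) ∧
        HLEStableOutside p q a b u v K := by
  rintro ⟨u, v, K, h, hu, hv, hK⟩
  exact (HLE.PosSol.of_isHLESol h hu hv).not_stableOutside hN hq0 hq1
    ((div_lt_iff₀ hq0).1 hp) ha hb hsub hK
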